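/- Let s ≥ 7 and m₀ > 1/2, let η ∈ ℋ^{s+4} satisfy condition (H), and let g be a global smooth solution of the filtered Vlasov-HMF equation with Q_{0,s}(g) ≤ R₀ and 0 < ε ≤ ε₀ as in the main a priori bound (so that Q_{T,s}(g) ≤ R for all T ≥ 0). Then there exist a constant C and a function g^∞(x,v) ∈ ℋ^{s−4} such that for every integer r with 1 ≤ r ≤ s−4 and all t ≥ 0: ‖g(t,·,·) − g^∞‖_{ℋ^r} ≤ C/⟨t⟩^{s−r−3}. -/

import Mathlib

open MeasureTheory Real Set

noncomputable section

/-- The measure on `𝕋 × ℝ`, with `𝕋 = ℝ/2πℤ` modeled as `(0, 2π] × ℝ ⊆ ℝ × ℝ`. -/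
def μTR : Measure (ℝ × ℝ) := (volume.restrict (Set.Ioc 0 (2 * π))).prod volume

/-- Partial derivative in the first (space) variable. -/
def pX (f : ℝ → ℝ → ℂ) : ℝ → ℝ → ℂ := fun x v => deriv (fun x' => f x' v) x

/-- Partial derivative in the second (velocity) variable. -/
def pV (f : ℝ → ℝ → ℂ) : ℝ → ℝ → ℂ := fun x v => deriv (fun v' => f x v') v

/-- The weighted integrand `(1+v²)^{m₀} |∂ₓᵖ ∂ᵥ^q f|²`. -/
def wInt (m0 : ℝ) (p q : ℕ) (f : ℝ → ℝ → ℂ) : ℝ × ℝ → ℝ :=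
  fun z => (1 + z.2 ^ 2) ^ m0 * ‖(pX^[p] (pV^[q] f)) z.1 z.2‖ ^ 2

/-- Square of the weighted Sobolev norm: `‖f‖_{ℋⁿ}² = ∑_{p+q ≤ n} ∫ (1+v²)^{m₀}|∂ₓᵖ∂ᵥ^q f|²`. -/
def HnormSq (m0 : ℝ) (n : ℕ) (f : ℝ → ℝ → ℂ) : ℝ :=
  ∑ p ∈ Finset.range (n + 1), ∑ q ∈ Finset.range (n + 1 - p), ∫ z, wInt m0 p q f z ∂μTR

/-- The weighted Sobolev norm `‖f‖_{ℋⁿ}`. -/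
def Hnorm (m0 : ℝ) (n : ℕ) (f : ℝ → ℝ → ℂ) : ℝ := Real.sqrt (HnormSq m0 n f)

/-- Membership in the weighted Sobolev space `ℋⁿ` on `𝕋 × ℝ`. -/
def MemH (m0 : ℝ) (n : ℕ) (f : ℝ → ℝ → ℂ) : Prop :=
  ContDiff ℝ n (Function.uncurry f) ∧
  (∀ v, Function.Periodic (fun x => f x v) (2 * π)) ∧
  ∀ p q : ℕ, p + q ≤ n → Integrable (wInt m0 p q f) μTR

/-- The Fourier coefficient `f̂ₖ(ξ) = (1/2π) ∫_{𝕋×ℝ} f(x,v) e^{-ikx-iξv} dx dv`. -/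
def fHat (f : ℝ → ℝ → ℂ) (k : ℤ) (ξ : ℝ) : ℂ :=
  (1 / (2 * π)) * ∫ z, f z.1 z.2 * Complex.exp (-Complex.I * ((k : ℝ) * z.1 + ξ * z.2)) ∂μTR

/-- The Japanese bracket `⟨t⟩ = (1+t²)^{1/2}`. -/
def jap (t : ℝ) : ℝ := Real.sqrt (1 + t ^ 2)

/-- The Fourier transform `η̂₀(ξ)` of a spatially homogeneous state `η = η(v)`. -/
def etaHat (η : ℝ → ℂ) (ξ : ℝ) : ℂ := fHat (fun _ v => η v) 0 ξ

/-- Fourier coefficients of the HMF kernel `P(x) = cos x`: `p_{±1} = 1/2`, `pₙ = 0` otherwise. -/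
def pcoef (n : ℤ) : ℂ := if n = 1 ∨ n = -1 then 1 / 2 else 0

/-- The kernel `K(n,t) = -n pₙ · nt · η̂₀(nt) 1_{t ≥ 0}`. -/
def Kker (η : ℝ → ℂ) (n : ℤ) (t : ℝ) : ℂ :=
  if 0 ≤ t then -(n : ℂ) * pcoef n * ((n : ℂ) * t) * etaHat η ((n : ℝ) * t) else 0

/-- The Fourier transform `K̂(n,τ) = ∫_ℝ e^{-iτt} K(n,t) dt`, for complex `τ`. -/
def KhatC (η : ℝ → ℂ) (n : ℤ) (τ : ℂ) : ℂ :=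
  ∫ t : ℝ, Complex.exp (-Complex.I * τ * (t : ℂ)) * Kker η n t

/-- The Penrose stability condition (H). -/
def Penrose (m0 : ℝ) (η : ℝ → ℂ) : Prop :=
  MemH m0 5 (fun _ v => (1 + (v : ℂ) ^ 2) * η v) ∧
  ∃ κ > 0, ∀ n : ℤ, n = 1 ∨ n = -1 → ∀ τ : ℂ, τ.im ≤ 0 → κ ≤ ‖1 - KhatC η n τ‖

/-- The Poisson bracket `{f,h} = ∂ₓf ∂ᵥh - ∂ᵥf ∂ₓh`. -/
def pbracket (f h : ℝ → ℝ → ℂ) : ℝ → ℝ → ℂ :=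
  fun x v => pX f x v * pV h x v - pV f x v * pX h x v

/-- The filtered HMF mean-field potential `φ(t,g)(x,v) = ∫ cos(x-y+t(v-u)) g(t,y,u) dy du`. -/
def phiHMF (g : ℝ → ℝ → ℝ → ℂ) (t : ℝ) : ℝ → ℝ → ℂ :=
  fun x v => ∫ z, (Real.cos (x - z.1 + t * (v - z.2)) : ℂ) * g t z.1 z.2 ∂μTR

/-- `g` solves the filtered Vlasov-HMF equation `∂ₜg = {φ(t,g), η} + ε{φ(t,g), g}`. -/
def IsVHMF (ε : ℝ) (η : ℝ → ℂ) (g : ℝ → ℝ → ℝ → ℂ) : Prop :=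
  ∀ t x v, HasDerivAt (fun τ => g τ x v)
    (pbracket (phiHMF g t) (fun _ w => η w) x v + ε * pbracket (phiHMF g t) (g t) x v) t

/-- Global smoothness (in all variables) of `g = g(t,x,v)`. -/
def SmoothG (g : ℝ → ℝ → ℝ → ℂ) : Prop :=
  ∀ n : ℕ, ContDiff ℝ n fun p : ℝ × ℝ × ℝ => g p.1 p.2.1 p.2.2

/-- `ζₖ(t) = ĝₖ(t, kt)`. -/
def zeta (g : ℝ → ℝ → ℝ → ℂ) (k : ℤ) (t : ℝ) : ℂ := fHat (g t) k ((k : ℝ) * t)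

/-- The bound `Q_{T,s}(g) ≤ R`, where
`Q_{T,s}(g) = sup_{[0,T]} ‖g(t)‖_{ℋˢ}/⟨t⟩³ + sup_{[0,T]} max_{k=±1} ⟨t⟩^{s-1}|ζₖ(t)| + sup_{[0,T]} ‖g(t)‖_{ℋ^{s-4}}`. -/
def Qle (m0 : ℝ) (s : ℕ) (g : ℝ → ℝ → ℝ → ℂ) (T R : ℝ) : Prop :=
  ∃ A B C : ℝ, A + B + C ≤ R ∧
    (∀ t ∈ Set.Icc (0 : ℝ) T, Hnorm m0 s (g t) / jap t ^ 3 ≤ A) ∧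
    (∀ t ∈ Set.Icc (0 : ℝ) T, ∀ k : ℤ, k = 1 ∨ k = -1 → jap t ^ (s - 1) * ‖zeta g k t‖ ≤ B) ∧
    (∀ t ∈ Set.Icc (0 : ℝ) T, Hnorm m0 (s - 4) (g t) ≤ C)

/-- The mixed partial derivative `∂ₓᵖ ∂ᵥ^q f`. -/
def dXV (p q : ℕ) (f : ℝ → ℝ → ℂ) : ℝ → ℝ → ℂ := pX^[p] (pV^[q] f)

lemma fderiv_fderiv_apply_comm {E : Type*} [NormedAddCommGroup E] [NormedSpace ℝ E] {f : E → ℂ}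
    (hf : ContDiff ℝ 2 f) (y a b : E) :
    fderiv ℝ (fun z => fderiv ℝ f z a) y b = fderiv ℝ (fun z => fderiv ℝ f z b) y a := by
  have hd : DifferentiableAt ℝ (fderiv ℝ f) y :=
    ((hf.fderiv_right (m := 1) (by norm_num)).differentiable (by norm_num)) y
  have hs : IsSymmSndFDerivAt ℝ f y := hf.contDiffAt.isSymmSndFDerivAt (by simp)
  rw [fderiv_clm_apply hd (by fun_prop), fderiv_clm_apply hd (by fun_prop)]
  simpa using hs b a

lemma contDiff_fderiv_apply_const {E : Type*} [NormedAddCommGroup E] [NormedSpace ℝ E]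
    {f : E → ℂ} {n : ℕ} (hf : ContDiff ℝ (n + 1 : ℕ) f) (a : E) :
    ContDiff ℝ n (fun z => fderiv ℝ f z a) :=
  (hf.fderiv_right (m := n) (by norm_cast)).clm_apply contDiff_const

lemma hasDerivAt_fst_slice {f : ℝ → ℝ → ℂ} {x v : ℝ}
    (hf : DifferentiableAt ℝ (Function.uncurry f) (x, v)) :
    HasDerivAt (fun x' => f x' v) (fderiv ℝ (Function.uncurry f) (x, v) (1, 0)) x :=
  hf.hasFDerivAt.comp_hasDerivAt (f := fun x' : ℝ => (x', v)) x
    ((hasDerivAt_id x).prodMk (hasDerivAt_const x v))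

lemma hasDerivAt_snd_slice {f : ℝ → ℝ → ℂ} {x v : ℝ}
    (hf : DifferentiableAt ℝ (Function.uncurry f) (x, v)) :
    HasDerivAt (fun v' => f x v') (fderiv ℝ (Function.uncurry f) (x, v) (0, 1)) v :=
  hf.hasFDerivAt.comp_hasDerivAt (f := fun v' : ℝ => (x, v')) v
    ((hasDerivAt_const v x).prodMk (hasDerivAt_id v))

lemma pX_eq_fderiv {f : ℝ → ℝ → ℂ} (hf : ContDiff ℝ 1 (Function.uncurry f)) (x v : ℝ) :
    pX f x v = fderiv ℝ (Function.uncurry f) (x, v) (1, 0) :=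
  (hasDerivAt_fst_slice (hf.differentiable (by norm_num) _)).deriv

lemma pV_eq_fderiv {f : ℝ → ℝ → ℂ} (hf : ContDiff ℝ 1 (Function.uncurry f)) (x v : ℝ) :
    pV f x v = fderiv ℝ (Function.uncurry f) (x, v) (0, 1) :=
  (hasDerivAt_snd_slice (hf.differentiable (by norm_num) _)).deriv

lemma uncurry_pX {f : ℝ → ℝ → ℂ} (hf : ContDiff ℝ 1 (Function.uncurry f)) :
    Function.uncurry (pX f) = fun z => fderiv ℝ (Function.uncurry f) z (1, 0) :=
  funext fun z => pX_eq_fderiv hf z.1 z.2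

lemma uncurry_pV {f : ℝ → ℝ → ℂ} (hf : ContDiff ℝ 1 (Function.uncurry f)) :
    Function.uncurry (pV f) = fun z => fderiv ℝ (Function.uncurry f) z (0, 1) :=
  funext fun z => pV_eq_fderiv hf z.1 z.2

lemma hasDerivAt_pX {f : ℝ → ℝ → ℂ} (hf : ContDiff ℝ 1 (Function.uncurry f)) (x v : ℝ) :
    HasDerivAt (fun x' => f x' v) (pX f x v) x := by
  rw [pX_eq_fderiv hf]
  exact hasDerivAt_fst_slice (hf.differentiable (by norm_num) _)

lemma hasDerivAt_pV {f : ℝ → ℝ → ℂ} (hf : ContDiff ℝ 1 (Function.uncurry f)) (x v : ℝ) :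
    HasDerivAt (fun v' => f x v') (pV f x v) v := by
  rw [pV_eq_fderiv hf]
  exact hasDerivAt_snd_slice (hf.differentiable (by norm_num) _)

lemma contDiff_one_of_succ {E : Type*} [NormedAddCommGroup E] [NormedSpace ℝ E]
    {f : E → ℂ} {n : ℕ} (hf : ContDiff ℝ (n + 1 : ℕ) f) : ContDiff ℝ 1 f :=
  hf.of_le (by norm_cast; omega)

lemma contDiff_pX {f : ℝ → ℝ → ℂ} {n : ℕ} (hf : ContDiff ℝ (n + 1 : ℕ) (Function.uncurry f)) :
    ContDiff ℝ n (Function.uncurry (pX f)) := by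
  rw [uncurry_pX (contDiff_one_of_succ hf)]
  exact contDiff_fderiv_apply_const hf _

lemma contDiff_pV {f : ℝ → ℝ → ℂ} {n : ℕ} (hf : ContDiff ℝ (n + 1 : ℕ) (Function.uncurry f)) :
    ContDiff ℝ n (Function.uncurry (pV f)) := by
  rw [uncurry_pV (contDiff_one_of_succ hf)]
  exact contDiff_fderiv_apply_const hf _

lemma pV_pX_comm {f : ℝ → ℝ → ℂ} (hf : ContDiff ℝ 2 (Function.uncurry f)) :
    pV (pX f) = pX (pV f) := by
  have h1 : ContDiff ℝ 1 (Function.uncurry f) := hf.of_le (by norm_num)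
  funext x v
  rw [pV_eq_fderiv (by exact_mod_cast contDiff_pX (n := 1) (by exact_mod_cast hf)),
    pX_eq_fderiv (by exact_mod_cast contDiff_pV (n := 1) (by exact_mod_cast hf)),
    uncurry_pX h1, uncurry_pV h1]
  exact fderiv_fderiv_apply_comm hf _ _ _

lemma contDiff_pX_iterate {n p : ℕ} : ∀ {f : ℝ → ℝ → ℂ},
    ContDiff ℝ (n + p : ℕ) (Function.uncurry f) → ContDiff ℝ n (Function.uncurry (pX^[p] f)) := by
  induction p with
  | zero => intro f hf; simpa using hf
  | succ p ih => intro f hf; exact ih (contDiff_pX (by simpa [add_assoc] using hf))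

lemma contDiff_pV_iterate {n q : ℕ} : ∀ {f : ℝ → ℝ → ℂ},
    ContDiff ℝ (n + q : ℕ) (Function.uncurry f) → ContDiff ℝ n (Function.uncurry (pV^[q] f)) := by
  induction q with
  | zero => intro f hf; simpa using hf
  | succ p ih => intro f hf; exact ih (contDiff_pV (by simpa [add_assoc] using hf))

lemma contDiff_dXV {n p q : ℕ} {f : ℝ → ℝ → ℂ}
    (hf : ContDiff ℝ (n + (p + q) : ℕ) (Function.uncurry f)) :
    ContDiff ℝ n (Function.uncurry (dXV p q f)) :=
  contDiff_pX_iterate (contDiff_pV_iterate (by simpa [add_assoc] using hf))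

lemma pX_iterate_pV_comm {p : ℕ} : ∀ {f : ℝ → ℝ → ℂ},
    ContDiff ℝ (p + 1 : ℕ) (Function.uncurry f) → pV (pX^[p] f) = pX^[p] (pV f) := by
  induction p with
  | zero => intro f _; rfl
  | succ p ih =>
    intro f hf
    rw [Function.iterate_succ_apply, Function.iterate_succ_apply, ih (contDiff_pX hf),
      pV_pX_comm (hf.of_le (by norm_cast; omega))]

lemma pV_iterate_pX_comm {q : ℕ} : ∀ {f : ℝ → ℝ → ℂ},
    ContDiff ℝ (q + 1 : ℕ) (Function.uncurry f) → pV^[q] (pX f) = pX (pV^[q] f) := by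
  induction q with
  | zero => intro f _; rfl
  | succ q ih =>
    intro f hf
    rw [Function.iterate_succ_apply, Function.iterate_succ_apply, ← ih (contDiff_pV hf),
      pV_pX_comm (hf.of_le (by norm_cast; omega))]

lemma pX_dXV (p q : ℕ) (f : ℝ → ℝ → ℂ) : pX (dXV p q f) = dXV (p + 1) q f :=
  (Function.iterate_succ_apply' _ _ _).symm

lemma pV_dXV {p q : ℕ} {f : ℝ → ℝ → ℂ} (hf : ContDiff ℝ (p + q + 1 : ℕ) (Function.uncurry f)) :
    pV (dXV p q f) = dXV p (q + 1) f := by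
  unfold dXV
  rw [pX_iterate_pV_comm (contDiff_pV_iterate (hf.of_le (by norm_cast; omega))),
    Function.iterate_succ_apply']

lemma dXV_pV (p q : ℕ) (f : ℝ → ℝ → ℂ) : dXV p q (pV f) = dXV p (q + 1) f := rfl

lemma dXV_pX {p q : ℕ} {f : ℝ → ℝ → ℂ} (hf : ContDiff ℝ (q + 1 : ℕ) (Function.uncurry f)) :
    dXV p q (pX f) = dXV (p + 1) q f := by
  unfold dXV
  rw [pV_iterate_pX_comm hf, Function.iterate_succ_apply]

lemma pX_iterate_apply (p : ℕ) (f : ℝ → ℝ → ℂ) (x v : ℝ) :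
    pX^[p] f x v = iteratedDeriv p (fun x' => f x' v) x := by
  induction p generalizing x with
  | zero => simp
  | succ p ih =>
    rw [Function.iterate_succ_apply', iteratedDeriv_succ]
    unfold pX at ih ⊢
    congr 1
    funext y
    exact ih y

lemma pV_iterate_apply (q : ℕ) (f : ℝ → ℝ → ℂ) (x v : ℝ) :
    pV^[q] f x v = iteratedDeriv q (fun v' => f x v') v := by
  induction q generalizing v with
  | zero => simp
  | succ p ih =>
    rw [Function.iterate_succ_apply', iteratedDeriv_succ]
    unfold pV at ih ⊢
    congr 1
    funext y
    exact ih y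

lemma contDiff_slice_fst {f : ℝ → ℝ → ℂ} {n : ℕ} (hf : ContDiff ℝ n (Function.uncurry f))
    (v : ℝ) : ContDiff ℝ n (fun x => f x v) :=
  hf.comp (contDiff_id.prodMk contDiff_const)

lemma contDiff_slice_snd {f : ℝ → ℝ → ℂ} {n : ℕ} (hf : ContDiff ℝ n (Function.uncurry f))
    (x : ℝ) : ContDiff ℝ n (fun v => f x v) :=
  hf.comp (contDiff_const.prodMk contDiff_id)

lemma dXV_linear_combination {ι : Type*} (S : Finset ι) (c : ι → ℂ) (F : ι → ℝ → ℝ → ℂ) {p q : ℕ}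
    (hF : ∀ i ∈ S, ContDiff ℝ (p + q : ℕ) (Function.uncurry (F i))) (x v : ℝ) :
    dXV p q (fun x v => ∑ i ∈ S, c i * F i x v) x v = ∑ i ∈ S, c i * dXV p q (F i) x v := by
  have h1 : pV^[q] (fun x v => ∑ i ∈ S, c i * F i x v)
      = fun x v => ∑ i ∈ S, c i * pV^[q] (F i) x v := by
    funext x v
    rw [pV_iterate_apply, iteratedDeriv_fun_sum]
    · refine Finset.sum_congr rfl fun i hi => ?_
      rw [iteratedDeriv_const_mul_field, pV_iterate_apply]
    · intro i hi
      exact (contDiff_const.mul (contDiff_slice_snd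
        ((hF i hi).of_le (by norm_cast; omega)) x)).contDiffAt
  unfold dXV
  rw [h1, pX_iterate_apply, iteratedDeriv_fun_sum]
  · refine Finset.sum_congr rfl fun i hi => ?_
    rw [iteratedDeriv_const_mul_field, pX_iterate_apply]
  · intro i hi
    exact (contDiff_const.mul (contDiff_slice_fst
      (contDiff_pV_iterate (n := p) (hF i hi)) v)).contDiffAt

lemma dXV_add_mul {f h : ℝ → ℝ → ℂ} {p q : ℕ} (c d : ℂ)
    (hf : ContDiff ℝ (p + q : ℕ) (Function.uncurry f))
    (hh : ContDiff ℝ (p + q : ℕ) (Function.uncurry h)) (x v : ℝ) :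
    dXV p q (fun x v => c * f x v + d * h x v) x v = c * dXV p q f x v + d * dXV p q h x v := by
  have := dXV_linear_combination (p := p) (q := q) Finset.univ ![c, d] ![f, h] (by
    intro i _; fin_cases i <;> simpa) x v
  simpa [Fin.sum_univ_two] using this

lemma iteratedDeriv_cexp_affine (n : ℕ) (a b : ℂ) (x : ℝ) :
    iteratedDeriv n (fun y : ℝ => Complex.exp (a * y + b)) x = a ^ n * Complex.exp (a * x + b) := by
  induction n generalizing x with
  | zero => simp
  | succ n ih =>
    rw [iteratedDeriv_succ, funext ih]
    have h : HasDerivAt (fun y : ℝ => a * (y : ℂ) + b) a x := by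
      simpa using ((hasDerivAt_id x).ofReal_comp.const_mul a).add_const b
    rw [(h.cexp.const_mul (a ^ n)).deriv]
    ring

lemma contDiff_cexp_affine₂ {n : ℕ} (a b : ℂ) :
    ContDiff ℝ n (fun z : ℝ × ℝ => Complex.exp (a * z.1 + b * z.2)) := by
  have h1 : ContDiff ℝ n (fun z : ℝ × ℝ => (z.1 : ℂ)) :=
    Complex.ofRealCLM.contDiff.comp contDiff_fst
  have h2 : ContDiff ℝ n (fun z : ℝ × ℝ => (z.2 : ℂ)) :=
    Complex.ofRealCLM.contDiff.comp contDiff_snd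
  exact ((contDiff_const.mul h1).add (contDiff_const.mul h2)).cexp

lemma dXV_cexp_mul {F : ℝ → ℝ → ℂ} {p q : ℕ} (a b : ℂ)
    (hF : ContDiff ℝ (p + q : ℕ) (Function.uncurry F)) (x v : ℝ) :
    dXV p q (fun (x v : ℝ) => Complex.exp (a * x + b * v) * F x v) x v =
      Complex.exp (a * x + b * v) * ∑ j ∈ Finset.range (q + 1), ∑ i ∈ Finset.range (p + 1),
        (q.choose j * b ^ j * (p.choose i * a ^ i)) * dXV (p - i) (q - j) F x v := by
  have h1 : pV^[q] (fun (x v : ℝ) => Complex.exp (a * x + b * v) * F x v) =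
      fun (x v : ℝ) => ∑ j ∈ Finset.range (q + 1),
        (q.choose j * b ^ j) * (Complex.exp (a * x + b * v) * pV^[q - j] F x v) := by
    funext x v
    rw [pV_iterate_apply, iteratedDeriv_fun_mul]
    · refine Finset.sum_congr rfl fun j hj => ?_
      have : (fun v' : ℝ => Complex.exp (a * x + b * v')) =
          fun v' : ℝ => Complex.exp (b * v' + a * x) := by simp [add_comm]
      rw [this, iteratedDeriv_cexp_affine, pV_iterate_apply, add_comm (b * (v : ℂ))]
      ring
    · exact ((contDiff_cexp_affine₂ a b).comp (contDiff_const.prodMk contDiff_id)).contDiffAt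
    · exact (contDiff_slice_snd (hF.of_le (by norm_cast; omega)) x).contDiffAt
  have h2 : ∀ j ∈ Finset.range (q + 1), ContDiff ℝ p (fun x : ℝ => pV^[q - j] F x v) := by
    intro j hj
    exact contDiff_slice_fst
      (contDiff_pV_iterate (n := p) (hF.of_le (by norm_cast; omega))) v
  have h3 : ContDiff ℝ p (fun x : ℝ => Complex.exp (a * x + b * v)) :=
    (contDiff_cexp_affine₂ a b).comp (contDiff_id.prodMk contDiff_const)
  unfold dXV
  rw [h1, pX_iterate_apply, iteratedDeriv_fun_sum]
  · rw [Finset.mul_sum]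
    refine Finset.sum_congr rfl fun j hj => ?_
    rw [iteratedDeriv_const_mul_field, iteratedDeriv_fun_mul h3.contDiffAt (h2 j hj).contDiffAt,
      Finset.mul_sum, Finset.mul_sum]
    refine Finset.sum_congr rfl fun i hi => ?_
    rw [iteratedDeriv_cexp_affine, pX_iterate_apply]
    ring
  · intro j hj
    exact (contDiff_const.mul (h3.mul (h2 j hj))).contDiffAt

/-- The time derivative `∂ₜ G`. -/
def pT (G : ℝ → ℝ → ℝ → ℂ) : ℝ → ℝ → ℝ → ℂ := fun t x v => deriv (fun τ => G τ x v) t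

lemma SmoothG.fderiv_apply {G : ℝ → ℝ → ℝ → ℂ} (hG : SmoothG G) (e : ℝ × ℝ × ℝ) :
    SmoothG (fun t x v => fderiv ℝ (fun p : ℝ × ℝ × ℝ => G p.1 p.2.1 p.2.2) (t, x, v) e) :=
  fun n => contDiff_fderiv_apply_const (hG (n + 1)) e

lemma SmoothG.contDiff_slice {G : ℝ → ℝ → ℝ → ℂ} (hG : SmoothG G) (n : ℕ) (t : ℝ) :
    ContDiff ℝ n (Function.uncurry (G t)) :=
  (hG n).comp (contDiff_const.prodMk contDiff_id)

lemma SmoothG.hasDerivAt_pT {G : ℝ → ℝ → ℝ → ℂ} (hG : SmoothG G) (t x v : ℝ) :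
    HasDerivAt (fun τ => G τ x v)
      (fderiv ℝ (fun p : ℝ × ℝ × ℝ => G p.1 p.2.1 p.2.2) (t, x, v) (1, 0, 0)) t :=
  ((hG 1).differentiable (by norm_num) (t, x, v)).hasFDerivAt.comp_hasDerivAt
    (f := fun τ : ℝ => (τ, x, v)) t ((hasDerivAt_id t).prodMk (hasDerivAt_const t (x, v)))

lemma SmoothG.pT_eq {G : ℝ → ℝ → ℝ → ℂ} (hG : SmoothG G) :
    pT G = fun t x v =>
      fderiv ℝ (fun p : ℝ × ℝ × ℝ => G p.1 p.2.1 p.2.2) (t, x, v) (1, 0, 0) := by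
  funext t x v
  exact (hG.hasDerivAt_pT t x v).deriv

lemma SmoothG.pX_eq {G : ℝ → ℝ → ℝ → ℂ} (hG : SmoothG G) :
    (fun t => pX (G t)) = fun t x v =>
      fderiv ℝ (fun p : ℝ × ℝ × ℝ => G p.1 p.2.1 p.2.2) (t, x, v) (0, 1, 0) := by
  funext t x v
  exact (((hG 1).differentiable (by norm_num) (t, x, v)).hasFDerivAt.comp_hasDerivAt
    (f := fun y : ℝ => (t, y, v)) x
    ((hasDerivAt_const x t).prodMk ((hasDerivAt_id x).prodMk (hasDerivAt_const x v)))).deriv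

lemma SmoothG.pV_eq {G : ℝ → ℝ → ℝ → ℂ} (hG : SmoothG G) :
    (fun t => pV (G t)) = fun t x v =>
      fderiv ℝ (fun p : ℝ × ℝ × ℝ => G p.1 p.2.1 p.2.2) (t, x, v) (0, 0, 1) := by
  funext t x v
  exact (((hG 1).differentiable (by norm_num) (t, x, v)).hasFDerivAt.comp_hasDerivAt
    (f := fun y : ℝ => (t, x, y)) v
    ((hasDerivAt_const v t).prodMk ((hasDerivAt_const v x).prodMk (hasDerivAt_id v)))).deriv

lemma SmoothG.pT {G : ℝ → ℝ → ℝ → ℂ} (hG : SmoothG G) : SmoothG (pT G) := by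
  rw [hG.pT_eq]; exact hG.fderiv_apply _

lemma SmoothG.pX {G : ℝ → ℝ → ℝ → ℂ} (hG : SmoothG G) : SmoothG (fun t => pX (G t)) := by
  rw [hG.pX_eq]; exact hG.fderiv_apply _

lemma SmoothG.pV {G : ℝ → ℝ → ℝ → ℂ} (hG : SmoothG G) : SmoothG (fun t => pV (G t)) := by
  rw [hG.pV_eq]; exact hG.fderiv_apply _

lemma SmoothG.pT_pX_comm {G : ℝ → ℝ → ℝ → ℂ} (hG : SmoothG G) :
    _root_.pT (fun t => _root_.pX (G t)) = fun t => _root_.pX (_root_.pT G t) := by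
  have h : (fun p : ℝ × ℝ × ℝ => _root_.pX (G p.1) p.2.1 p.2.2) = fun p =>
      fderiv ℝ (fun p : ℝ × ℝ × ℝ => G p.1 p.2.1 p.2.2) p (0, 1, 0) :=
    funext fun p => congrFun₃ hG.pX_eq p.1 p.2.1 p.2.2
  rw [hG.pX.pT_eq, hG.pT.pX_eq, hG.pT_eq, h]
  funext t x v
  exact fderiv_fderiv_apply_comm (hG 2) _ _ _

lemma SmoothG.pT_pV_comm {G : ℝ → ℝ → ℝ → ℂ} (hG : SmoothG G) :
    _root_.pT (fun t => _root_.pV (G t)) = fun t => _root_.pV (_root_.pT G t) := by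
  have h : (fun p : ℝ × ℝ × ℝ => _root_.pV (G p.1) p.2.1 p.2.2) = fun p =>
      fderiv ℝ (fun p : ℝ × ℝ × ℝ => G p.1 p.2.1 p.2.2) p (0, 0, 1) :=
    funext fun p => congrFun₃ hG.pV_eq p.1 p.2.1 p.2.2
  rw [hG.pV.pT_eq, hG.pT.pV_eq, hG.pT_eq, h]
  funext t x v
  exact fderiv_fderiv_apply_comm (hG 2) _ _ _

lemma SmoothG.pX_iterate (p : ℕ) : ∀ {G : ℝ → ℝ → ℝ → ℂ}, SmoothG G →
    SmoothG (fun t => _root_.pX^[p] (G t)) ∧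
      _root_.pT (fun t => _root_.pX^[p] (G t)) = fun t => _root_.pX^[p] (_root_.pT G t) := by
  induction p with
  | zero => exact fun hG => ⟨hG, rfl⟩
  | succ p ih =>
    intro G hG
    refine ⟨(ih hG.pX).1, (ih hG.pX).2.trans ?_⟩
    rw [hG.pT_pX_comm]
    rfl

lemma SmoothG.pV_iterate (p : ℕ) : ∀ {G : ℝ → ℝ → ℝ → ℂ}, SmoothG G →
    SmoothG (fun t => _root_.pV^[p] (G t)) ∧
      _root_.pT (fun t => _root_.pV^[p] (G t)) = fun t => _root_.pV^[p] (_root_.pT G t) := by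
  induction p with
  | zero => exact fun hG => ⟨hG, rfl⟩
  | succ p ih =>
    intro G hG
    refine ⟨(ih hG.pV).1, (ih hG.pV).2.trans ?_⟩
    rw [hG.pT_pV_comm]
    rfl

lemma SmoothG.dXV {G : ℝ → ℝ → ℝ → ℂ} (hG : SmoothG G) (p q : ℕ) :
    SmoothG (fun t => dXV p q (G t)) :=
  (SmoothG.pX_iterate p (SmoothG.pV_iterate q hG).1).1

lemma SmoothG.hasDerivAt_dXV {G : ℝ → ℝ → ℝ → ℂ} (hG : SmoothG G) (p q : ℕ) (t x v : ℝ) :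
    HasDerivAt (fun τ => _root_.dXV p q (G τ) x v) (_root_.dXV p q (_root_.pT G t) x v) t := by
  have h := (hG.dXV p q).hasDerivAt_pT t x v
  rw [← congrFun₃ (hG.dXV p q).pT_eq t x v] at h
  have h2 : _root_.pT (fun t => _root_.dXV p q (G t)) = fun t => _root_.dXV p q (_root_.pT G t) := by
    unfold _root_.dXV
    rw [(SmoothG.pX_iterate p (SmoothG.pV_iterate q hG).1).2, (SmoothG.pV_iterate q hG).2]
  rwa [h2] at h

lemma zeta_eq (g : ℝ → ℝ → ℝ → ℂ) (k : ℤ) (t : ℝ) :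
    ∫ z, g t z.1 z.2 * Complex.exp (-(Complex.I * k * (z.1 + t * z.2))) ∂μTR
      = 2 * π * zeta g k t := by
  unfold zeta fHat
  rw [← mul_assoc, mul_one_div_cancel (by simp [Real.pi_ne_zero]), one_mul]
  refine integral_congr_ae (Filter.Eventually.of_forall fun z => ?_)
  push_cast
  congr 2
  ring

lemma integrable_mul_cexp {f : ℝ × ℝ → ℂ} (hf : Integrable f μTR) (k : ℤ) (t : ℝ) :
    Integrable (fun z => f z * Complex.exp (-(Complex.I * k * (z.1 + t * z.2)))) μTR := by
  refine hf.mono (hf.1.mul (Continuous.aestronglyMeasurable (by fun_prop)))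
    (Filter.Eventually.of_forall fun z => ?_)
  rw [norm_mul]
  have : ‖Complex.exp (-(Complex.I * k * (z.1 + t * z.2)))‖ = 1 := by
    rw [Complex.norm_exp]; simp
  rw [this, mul_one]

lemma phiHMF_eq {g : ℝ → ℝ → ℝ → ℂ} {t : ℝ}
    (hg : Integrable (fun z : ℝ × ℝ => g t z.1 z.2) μTR) (x v : ℝ) :
    phiHMF g t x v = π * zeta g 1 t * Complex.exp (Complex.I * x + Complex.I * t * v)
      + π * zeta g (-1) t * Complex.exp (-Complex.I * x + -Complex.I * t * v) := by
  have h1 := integrable_mul_cexp hg 1 t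
  have h2 := integrable_mul_cexp hg (-1) t
  have e1 := zeta_eq g 1 t
  have e2 := zeta_eq g (-1) t
  have : phiHMF g t x v =
      ∫ z, (Complex.exp (Complex.I * x + Complex.I * t * v) / 2) *
          (g t z.1 z.2 * Complex.exp (-(Complex.I * (1 : ℤ) * (z.1 + t * z.2))))
        + (Complex.exp (-Complex.I * x + -Complex.I * t * v) / 2) *
          (g t z.1 z.2 * Complex.exp (-(Complex.I * (-1 : ℤ) * (z.1 + t * z.2)))) ∂μTR := by
    unfold phiHMF
    refine integral_congr_ae (Filter.Eventually.of_forall fun z => ?_)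
    simp only
    push_cast
    rw [Complex.cos]
    have a1 : Complex.exp ((↑x - ↑z.1 + ↑t * (↑v - ↑z.2)) * Complex.I) =
      Complex.exp (Complex.I * x + Complex.I * t * v) *
        Complex.exp (-(Complex.I * 1 * (z.1 + t * z.2))) := by
      rw [← Complex.exp_add]; congr 1; ring
    have a2 : Complex.exp (-(↑x - ↑z.1 + ↑t * (↑v - ↑z.2)) * Complex.I) =
      Complex.exp (-Complex.I * x + -Complex.I * t * v) *
        Complex.exp (-(Complex.I * -1 * (z.1 + t * z.2))) := by
      rw [← Complex.exp_add]; congr 1; ring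
    rw [a1, a2]
    ring
  rw [this, integral_add (h1.const_mul _) (h2.const_mul _), integral_const_mul, integral_const_mul,
    e1, e2]
  ring

/-- The full distribution `η + ε g(t)` driven by the mean field. -/
def totalState (ε : ℝ) (η : ℝ → ℂ) (g : ℝ → ℝ → ℝ → ℂ) (t : ℝ) : ℝ → ℝ → ℂ :=
  fun x v => 1 * η v + ε * g t x v

lemma contDiff_totalState {ε : ℝ} {η : ℝ → ℂ} {g : ℝ → ℝ → ℝ → ℂ} {n : ℕ}
    (hη : ContDiff ℝ n (Function.uncurry fun _ : ℝ => η)) (hg : SmoothG g) (t : ℝ) :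
    ContDiff ℝ n (Function.uncurry (totalState ε η g t)) :=
  (contDiff_const.mul hη).add (contDiff_const.mul (hg.contDiff_slice n t))

lemma pT_eq_sum {ε : ℝ} {η : ℝ → ℂ} {g : ℝ → ℝ → ℝ → ℂ}
    (hη : ContDiff ℝ 1 (Function.uncurry fun _ : ℝ => η)) (hg : SmoothG g)
    (hsol : IsVHMF ε η g) {t : ℝ} (hgi : Integrable (fun z : ℝ × ℝ => g t z.1 z.2) μTR) :
    pT g t = fun (x v : ℝ) => ∑ k ∈ ({1, -1} : Finset ℤ), (π * Complex.I * k * zeta g k t) *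
      (Complex.exp (Complex.I * k * x + Complex.I * k * t * v) *
        (1 * pV (totalState ε η g t) x v + (-t) * pX (totalState ε η g t) x v)) := by
  funext x v
  have hgt : ContDiff ℝ 1 (Function.uncurry (g t)) := by exact_mod_cast hg.contDiff_slice 1 t
  have hX : pX (totalState ε η g t) x v = ε * pX (g t) x v := by
    refine HasDerivAt.deriv ?_
    exact ((hasDerivAt_pX hgt x v).const_mul (ε : ℂ)).const_add (1 * η v)
  have hV : pV (totalState ε η g t) x v = pV (fun _ w => η w) x v + ε * pV (g t) x v := by
    refine HasDerivAt.deriv ?_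
    have := ((hasDerivAt_pV hη x v).const_mul 1).add ((hasDerivAt_pV hgt x v).const_mul (ε : ℂ))
    rwa [one_mul] at this
  have hηX : pX (fun _ w => η w) x v = 0 := by simp [pX]
  have hphi : phiHMF g t = fun (x v : ℝ) =>
      π * zeta g 1 t * Complex.exp (Complex.I * x + Complex.I * t * v)
      + π * zeta g (-1) t * Complex.exp (-Complex.I * x + -Complex.I * t * v) := by
    funext x v; exact phiHMF_eq hgi x v
  have hofx : HasDerivAt (fun y : ℝ => (y : ℂ)) 1 x := (hasDerivAt_id x).ofReal_comp
  have hofv : HasDerivAt (fun y : ℝ => (y : ℂ)) 1 v := (hasDerivAt_id v).ofReal_comp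
  have hpX : pX (phiHMF g t) x v =
      π * zeta g 1 t * (Complex.exp (Complex.I * x + Complex.I * t * v) * (Complex.I * 1))
      + π * zeta g (-1) t *
        (Complex.exp (-Complex.I * x + -Complex.I * t * v) * (-Complex.I * 1)) := by
    rw [hphi]
    exact HasDerivAt.deriv (((((hofx.const_mul _).add_const _).cexp).const_mul _).add
      ((((hofx.const_mul _).add_const _).cexp).const_mul _))
  have hpV : pV (phiHMF g t) x v =
      π * zeta g 1 t * (Complex.exp (Complex.I * x + Complex.I * t * v) * (Complex.I * t * 1))
      + π * zeta g (-1) t *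
        (Complex.exp (-Complex.I * x + -Complex.I * t * v) * (-Complex.I * t * 1)) := by
    rw [hphi]
    exact HasDerivAt.deriv (((((hofv.const_mul _).const_add _).cexp).const_mul _).add
      ((((hofv.const_mul _).const_add _).cexp).const_mul _))
  have hT : pT g t x v = _ := (hsol t x v).deriv
  rw [hT, Finset.sum_pair (by norm_num)]
  unfold pbracket
  rw [hpX, hpV, hηX, hX, hV]
  push_cast
  simp only [mul_one, mul_neg, neg_mul]
  ring

lemma one_le_jap (t : ℝ) : 1 ≤ jap t := Real.one_le_sqrt.2 (by nlinarith [sq_nonneg t])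

lemma jap_pos (t : ℝ) : 0 < jap t := zero_lt_one.trans_le (one_le_jap t)

lemma abs_le_jap (t : ℝ) : |t| ≤ jap t := Real.abs_le_sqrt (by linarith)

lemma jap_sq (t : ℝ) : jap t ^ 2 = 1 + t ^ 2 := Real.sq_sqrt (by positivity)

lemma continuous_jap : Continuous jap := by unfold jap; fun_prop

lemma dXV_pT_eq {ε : ℝ} {η : ℝ → ℂ} {g : ℝ → ℝ → ℝ → ℂ} {p q : ℕ}
    (hη : ContDiff ℝ (p + q + 1 : ℕ) (Function.uncurry fun _ : ℝ => η)) (hg : SmoothG g)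
    (hsol : IsVHMF ε η g) {t : ℝ} (hgi : Integrable (fun z : ℝ × ℝ => g t z.1 z.2) μTR)
    (x v : ℝ) :
    dXV p q (pT g t) x v = ∑ k ∈ ({1, -1} : Finset ℤ), (π * Complex.I * k * zeta g k t) *
      (Complex.exp (Complex.I * k * x + Complex.I * k * t * v) *
        ∑ j ∈ Finset.range (q + 1), ∑ i ∈ Finset.range (p + 1),
        (q.choose j * (Complex.I * k * t) ^ j * (p.choose i * (Complex.I * k) ^ i)) *
          (1 * dXV (p - i) (q - j + 1) (totalState ε η g t) x v
            + (-t) * dXV (p - i + 1) (q - j) (totalState ε η g t) x v)) := by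
  have hh := contDiff_totalState (ε := ε) hη hg t
  have h1 : ContDiff ℝ (p + q : ℕ) (Function.uncurry (fun (x v : ℝ) =>
      1 * pV (totalState ε η g t) x v + (-(t : ℂ)) * pX (totalState ε η g t) x v)) :=
    (contDiff_const.mul (contDiff_pV hh)).add (contDiff_const.mul (contDiff_pX hh))
  rw [pT_eq_sum (hη.of_le (by norm_cast; omega)) hg hsol hgi, dXV_linear_combination]
  · refine Finset.sum_congr rfl fun k _ => ?_
    rw [dXV_cexp_mul _ _ h1]
    congr 2
    refine Finset.sum_congr rfl fun j _ => Finset.sum_congr rfl fun i _ => ?_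
    rw [dXV_add_mul _ _ ((contDiff_pV hh).of_le (by norm_cast; omega))
      ((contDiff_pX hh).of_le (by norm_cast; omega)), dXV_pV,
      dXV_pX (hh.of_le (by norm_cast; omega))]
  · intro k _
    exact (contDiff_cexp_affine₂ _ _).mul h1

lemma norm_dXV_pT_le {ε R T : ℝ} {η : ℝ → ℂ} {g : ℝ → ℝ → ℝ → ℂ} {p q s : ℕ} (hs : 2 ≤ s)
    (hη : ContDiff ℝ (p + q + 1 : ℕ) (Function.uncurry fun _ : ℝ => η)) (hg : SmoothG g)
    (hsol : IsVHMF ε η g) {t : ℝ} (hgi : Integrable (fun z : ℝ × ℝ => g t z.1 z.2) μTR)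
    (hz : ∀ k : ℤ, k = 1 ∨ k = -1 → jap t ^ (s - 1) * ‖zeta g k t‖ ≤ R) (x v : ℝ)
    (hT : ∀ a b l : ℕ, l ≤ p + q → a + b = l + 1 →
      jap t ^ (p + q - l) * ‖dXV a b (totalState ε η g t) x v‖ ≤ T) :
    jap t ^ (s - 2) * ‖dXV p q (pT g t) x v‖ ≤
      (2 * (π * R * ((q + 1) * ((p + 1) * (2 ^ q * 2 ^ p * 2))))) * T := by
  have hJ := one_le_jap t
  have hJ0 := jap_pos t
  have hR : 0 ≤ R := le_trans (by positivity) (hz 1 (Or.inl rfl))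
  have hT0 : 0 ≤ T := le_trans (by positivity) (hT 1 0 0 (Nat.zero_le _) rfl)
  have hterm : ∀ k ∈ ({1, -1} : Finset ℤ), ∀ j ∈ Finset.range (q + 1), ∀ i ∈ Finset.range (p + 1),
      ‖((q.choose j * (Complex.I * k * t) ^ j * (p.choose i * (Complex.I * k) ^ i)) *
          (1 * dXV (p - i) (q - j + 1) (totalState ε η g t) x v
            + (-t) * dXV (p - i + 1) (q - j) (totalState ε η g t) x v) : ℂ)‖
        ≤ 2 ^ q * 2 ^ p * 2 * (jap t * T) := by
    intro k hk j hj i hi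
    have hk1 : ‖(k : ℂ)‖ = 1 := by
      rcases Finset.mem_insert.1 hk with h | h
      · simp [h]
      · simp [Finset.mem_singleton.1 h]
    rw [Finset.mem_range] at hi hj
    have hq : (q.choose j : ℝ) ≤ 2 ^ q := by exact_mod_cast Nat.choose_le_two_pow q j
    have hp : (p.choose i : ℝ) ≤ 2 ^ p := by exact_mod_cast Nat.choose_le_two_pow p i
    have A1 := hT (p - i) (q - j + 1) (p - i + (q - j)) (by omega) (by omega)
    have A2 := hT (p - i + 1) (q - j) (p - i + (q - j)) (by omega) (by omega)
    have hpow : |t| ^ j ≤ jap t ^ (p + q - (p - i + (q - j))) :=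
      (pow_le_pow_left₀ (abs_nonneg _) (abs_le_jap t) j).trans
        (pow_le_pow_right₀ hJ (by omega))
    have B1 : |t| ^ j * ‖dXV (p - i) (q - j + 1) (totalState ε η g t) x v‖ ≤ T :=
      (mul_le_mul_of_nonneg_right hpow (norm_nonneg _)).trans A1
    have B2 : |t| ^ j * ‖dXV (p - i + 1) (q - j) (totalState ε η g t) x v‖ ≤ T :=
      (mul_le_mul_of_nonneg_right hpow (norm_nonneg _)).trans A2
    have hn : ‖(q.choose j * (Complex.I * k * t) ^ j * (p.choose i * (Complex.I * k) ^ i) : ℂ)‖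
        = q.choose j * p.choose i * |t| ^ j := by
      simp only [norm_mul, norm_pow, hk1, Complex.norm_I, Complex.norm_natCast, Complex.norm_real,
        Real.norm_eq_abs, one_pow, mul_one, one_mul]
      ring
    rw [norm_mul, hn]
    have hsum : ‖(1 * dXV (p - i) (q - j + 1) (totalState ε η g t) x v
            + (-t) * dXV (p - i + 1) (q - j) (totalState ε η g t) x v : ℂ)‖
        ≤ ‖dXV (p - i) (q - j + 1) (totalState ε η g t) x v‖ +
          jap t * ‖dXV (p - i + 1) (q - j) (totalState ε η g t) x v‖ := by
      refine (norm_add_le _ _).trans ?_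
      rw [one_mul, norm_mul, norm_neg, Complex.norm_real, Real.norm_eq_abs]
      gcongr
      exact abs_le_jap t
    calc _ ≤ (q.choose j * p.choose i * |t| ^ j) *
          (‖dXV (p - i) (q - j + 1) (totalState ε η g t) x v‖ +
          jap t * ‖dXV (p - i + 1) (q - j) (totalState ε η g t) x v‖) := by gcongr
      _ = (q.choose j * p.choose i) *
          (|t| ^ j * ‖dXV (p - i) (q - j + 1) (totalState ε η g t) x v‖ +
          jap t * (|t| ^ j * ‖dXV (p - i + 1) (q - j) (totalState ε η g t) x v‖)) := by ring
      _ ≤ (2 ^ q * 2 ^ p) * (jap t * T + jap t * T) := by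
          exact mul_le_mul (mul_le_mul hq hp (by positivity) (by positivity))
            (add_le_add (B1.trans (le_mul_of_one_le_left hT0 hJ))
              (mul_le_mul_of_nonneg_left B2 hJ0.le)) (by positivity) (by positivity)
      _ = _ := by ring
  have hk : ∀ k ∈ ({1, -1} : Finset ℤ), ‖((π * Complex.I * k * zeta g k t) *
      (Complex.exp (Complex.I * k * x + Complex.I * k * t * v) *
        ∑ j ∈ Finset.range (q + 1), ∑ i ∈ Finset.range (p + 1),
        (q.choose j * (Complex.I * k * t) ^ j * (p.choose i * (Complex.I * k) ^ i)) *
          (1 * dXV (p - i) (q - j + 1) (totalState ε η g t) x v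
            + (-t) * dXV (p - i + 1) (q - j) (totalState ε η g t) x v)) : ℂ)‖ ≤
        π * ‖zeta g k t‖ * ((q + 1) * ((p + 1) * (2 ^ q * 2 ^ p * 2 * (jap t * T)))) := by
    intro k hk
    have hk1 : ‖(k : ℂ)‖ = 1 := by
      rcases Finset.mem_insert.1 hk with h | h
      · simp [h]
      · simp [Finset.mem_singleton.1 h]
    have he : ‖Complex.exp (Complex.I * k * x + Complex.I * k * t * v)‖ = 1 := by
      rw [Complex.norm_exp]; simp
    rw [norm_mul, norm_mul _ (Finset.sum _ _), he, one_mul]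
    have hz' : ‖(π * Complex.I * k * zeta g k t : ℂ)‖ = π * ‖zeta g k t‖ := by
      simp only [norm_mul, hk1, Complex.norm_I, Complex.norm_real, Real.norm_eq_abs,
        abs_of_pos Real.pi_pos, mul_one]
    rw [hz']
    refine mul_le_mul_of_nonneg_left ?_ (by positivity)
    refine (norm_sum_le_of_le _ fun j hj => norm_sum_le_of_le _ fun i hi => hterm k hk j hj i hi).trans
      (le_of_eq ?_)
    simp
  rw [dXV_pT_eq hη hg hsol hgi]
  have hsum := (norm_sum_le_of_le _ hk).trans_eq (Finset.sum_pair (by norm_num))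
  have hz1 := hz 1 (Or.inl rfl)
  have hz2 := hz (-1) (Or.inr rfl)
  have hpow : jap t ^ (s - 1) = jap t ^ (s - 2) * jap t := by
    rw [← pow_succ]; congr 1; omega
  rw [hpow] at hz1 hz2
  set K : ℝ := (q + 1) * ((p + 1) * (2 ^ q * 2 ^ p * 2)) with hK
  have hK0 : 0 ≤ K := by positivity
  calc _ ≤ jap t ^ (s - 2) * _ := mul_le_mul_of_nonneg_left hsum (by positivity)
    _ = π * (jap t ^ (s - 2) * jap t * ‖zeta g 1 t‖) * K * T +
        π * (jap t ^ (s - 2) * jap t * ‖zeta g (-1) t‖) * K * T := by rw [hK]; ring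
    _ ≤ π * R * K * T + π * R * K * T := by gcongr
    _ = _ := by ring

lemma wInt_eq (m0 : ℝ) (p q : ℕ) (f : ℝ → ℝ → ℂ) (z : ℝ × ℝ) :
    wInt m0 p q f z = (1 + z.2 ^ 2) ^ m0 * ‖dXV p q f z.1 z.2‖ ^ 2 := rfl

lemma weight_pos (m0 : ℝ) (z : ℝ × ℝ) : 0 < (1 + z.2 ^ 2) ^ m0 :=
  Real.rpow_pos_of_pos (by positivity) _

lemma wInt_nonneg (m0 : ℝ) (p q : ℕ) (f : ℝ → ℝ → ℂ) (z : ℝ × ℝ) : 0 ≤ wInt m0 p q f z :=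
  mul_nonneg (weight_pos m0 z).le (sq_nonneg _)

lemma sq_norm_le_wInt {m0 : ℝ} (hm0 : 0 ≤ m0) (p q : ℕ) (f : ℝ → ℝ → ℂ) (z : ℝ × ℝ) :
    ‖dXV p q f z.1 z.2‖ ^ 2 ≤ wInt m0 p q f z :=
  le_mul_of_one_le_left (sq_nonneg _)
    (Real.one_le_rpow (by nlinarith [sq_nonneg z.2]) hm0)

lemma integral_wInt_le_HnormSq (m0 : ℝ) {p q n : ℕ} (h : p + q ≤ n) (f : ℝ → ℝ → ℂ) :
    ∫ z, wInt m0 p q f z ∂μTR ≤ HnormSq m0 n f := by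
  have hnn : ∀ p q, 0 ≤ ∫ z, wInt m0 p q f z ∂μTR :=
    fun p q => integral_nonneg (wInt_nonneg m0 p q f)
  unfold HnormSq
  refine le_trans ?_ (Finset.single_le_sum
    (f := fun p => ∑ q ∈ Finset.range (n + 1 - p), ∫ z, wInt m0 p q f z ∂μTR)
    (fun i _ => Finset.sum_nonneg fun j _ => hnn i j) (Finset.mem_range.2 (by omega : p < n + 1)))
  exact Finset.single_le_sum (f := fun q => ∫ z, wInt m0 p q f z ∂μTR)
    (fun j _ => hnn p j) (Finset.mem_range.2 (by omega))

lemma HnormSq_nonneg (m0 : ℝ) (n : ℕ) (f : ℝ → ℝ → ℂ) : 0 ≤ HnormSq m0 n f :=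
  Finset.sum_nonneg fun p _ => Finset.sum_nonneg fun q _ => integral_nonneg (wInt_nonneg m0 p q f)

lemma sq_Hnorm (m0 : ℝ) (n : ℕ) (f : ℝ → ℝ → ℂ) : Hnorm m0 n f ^ 2 = HnormSq m0 n f :=
  Real.sq_sqrt (HnormSq_nonneg m0 n f)

lemma Hnorm_nonneg (m0 : ℝ) (n : ℕ) (f : ℝ → ℝ → ℂ) : 0 ≤ Hnorm m0 n f := Real.sqrt_nonneg _

lemma sq_norm_le_setIntegral {φ φ' : ℝ → ℂ} (hφ : ∀ y, HasDerivAt φ (φ' y) y)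
    (hc : Continuous φ') {a b : ℝ} (hab : 1 ≤ b - a) {x : ℝ} (hx : x ∈ Icc a b) :
    ‖φ x‖ ^ 2 ≤ ∫ y in a..b, 2 * (‖φ y‖ ^ 2 + ‖φ' y‖ ^ 2) := by
  have hcφ : Continuous φ := continuous_iff_continuousAt.2 fun y => (hφ y).continuousAt
  have hab' : a ≤ b := by linarith
  have hder : ∀ y, HasDerivAt (fun y => ‖φ y‖ ^ 2) (2 * inner ℝ (φ y) (φ' y)) y :=
    fun y => (hφ y).norm_sq
  have hci : Continuous fun y => 2 * inner ℝ (φ y) (φ' y) :=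
    continuous_const.mul (hcφ.inner hc)
  have hcs : Continuous fun y => ‖φ y‖ ^ 2 + ‖φ' y‖ ^ 2 := by fun_prop
  have hbd : ∀ y, |2 * inner ℝ (φ y) (φ' y)| ≤ ‖φ y‖ ^ 2 + ‖φ' y‖ ^ 2 := by
    intro y
    rw [abs_mul, abs_two]
    nlinarith [abs_real_inner_le_norm (φ y) (φ' y), sq_nonneg (‖φ y‖ - ‖φ' y‖)]
  set M := ∫ y in a..b, (‖φ y‖ ^ 2 + ‖φ' y‖ ^ 2) with hM
  have key : ∀ y ∈ Icc a b, ‖φ x‖ ^ 2 ≤ ‖φ y‖ ^ 2 + M := by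
    intro y hy
    have h1 : ∫ w in y..x, 2 * inner ℝ (φ w) (φ' w) = ‖φ x‖ ^ 2 - ‖φ y‖ ^ 2 :=
      intervalIntegral.integral_eq_sub_of_hasDerivAt (fun w _ => hder w)
        (hci.intervalIntegrable _ _)
    have h2 : ∫ w in y..x, 2 * inner ℝ (φ w) (φ' w) ≤ M := by
      refine (le_abs_self _).trans ?_
      rw [intervalIntegral.abs_integral_eq_abs_integral_uIoc]
      refine (abs_integral_le_integral_abs).trans ?_
      rw [hM, intervalIntegral.integral_of_le hab']
      calc _ ≤ ∫ w in Set.uIoc y x, (‖φ w‖ ^ 2 + ‖φ' w‖ ^ 2) := by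
            refine integral_mono_of_nonneg (Filter.Eventually.of_forall fun _ => abs_nonneg _) ?_
              (Filter.Eventually.of_forall hbd)
            exact (hcs.integrableOn_uIcc (a := y) (b := x)).mono_set uIoc_subset_uIcc
        _ ≤ _ := by
            refine setIntegral_mono_set (hcs.integrableOn_Icc.mono_set Ioc_subset_Icc_self)
              (Filter.Eventually.of_forall fun _ => by positivity) ?_
            refine LE.le.eventuallyLE ?_
            exact Ioc_subset_Ioc (le_min hy.1 hx.1) (max_le hy.2 hx.2)
    linarith
  have h3 : ∫ _ in a..b, (‖φ x‖ ^ 2 - M) ≤ ∫ y in a..b, ‖φ y‖ ^ 2 :=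
    intervalIntegral.integral_mono_on hab' (by simp) ((hcφ.norm.pow 2).intervalIntegrable _ _)
      fun y hy => by linarith [key y hy]
  have h4 : ∫ y in a..b, ‖φ y‖ ^ 2 ≤ M :=
    intervalIntegral.integral_mono_on hab' ((hcφ.norm.pow 2).intervalIntegrable _ _)
      (hcs.intervalIntegrable _ _) fun y hy => by nlinarith [sq_nonneg ‖φ' y‖]
  rw [intervalIntegral.integral_const, smul_eq_mul] at h3
  rw [intervalIntegral.integral_const_mul, ← hM]
  by_contra hcon
  push Not at hcon
  nlinarith

lemma ofReal_sq_norm_le_lintegral {φ φ' : ℝ → ℂ} (hφ : ∀ y, HasDerivAt φ (φ' y) y)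
    (hc : Continuous φ') {a b : ℝ} (hab : 1 ≤ b - a) {x : ℝ} (hx : x ∈ Icc a b) :
    ENNReal.ofReal (‖φ x‖ ^ 2) ≤
      ∫⁻ y in Ioc a b, ENNReal.ofReal (2 * (‖φ y‖ ^ 2 + ‖φ' y‖ ^ 2)) := by
  have hcφ : Continuous φ := continuous_iff_continuousAt.2 fun y => (hφ y).continuousAt
  have hcs : Continuous fun y => 2 * (‖φ y‖ ^ 2 + ‖φ' y‖ ^ 2) := by fun_prop
  rw [← ofReal_integral_eq_lintegral_ofReal
    (hcs.integrableOn_Icc.mono_set Ioc_subset_Icc_self)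
    (Filter.Eventually.of_forall fun _ => by positivity),
    ← intervalIntegral.integral_of_le (by linarith)]
  exact ENNReal.ofReal_le_ofReal (sq_norm_le_setIntegral hφ hc hab hx)

lemma ofReal_sq_norm_le_lintegral_prod {F : ℝ → ℝ → ℂ} (hF : ContDiff ℝ 2 (Function.uncurry F))
    (hper : ∀ v, Function.Periodic (fun x => F x v) (2 * π)) (x v : ℝ) :
    ENNReal.ofReal (‖F x v‖ ^ 2) ≤ ∫⁻ z, ENNReal.ofReal (4 * (‖F z.1 z.2‖ ^ 2 +
      ‖pV F z.1 z.2‖ ^ 2 + ‖pX F z.1 z.2‖ ^ 2 + ‖pV (pX F) z.1 z.2‖ ^ 2)) ∂μTR := by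
  obtain ⟨y, hy, hxy⟩ := (hper v).exists_mem_Ioc (by positivity) x 0
  have hF1 : ContDiff ℝ 1 (Function.uncurry F) := hF.of_le (by norm_num)
  have hX : ContDiff ℝ 1 (Function.uncurry (pX F)) := by
    exact_mod_cast contDiff_pX (n := 1) (by exact_mod_cast hF)
  have hV : ContDiff ℝ 1 (Function.uncurry (pV F)) := by
    exact_mod_cast contDiff_pV (n := 1) (by exact_mod_cast hF)
  have hXV : Continuous (Function.uncurry (pV (pX F))) :=
    (contDiff_pV (n := 0) (by exact_mod_cast hX)).continuous
  have c0 : Continuous fun z : ℝ × ℝ => F z.1 z.2 := hF1.continuous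
  have c1 : Continuous fun z : ℝ × ℝ => pV F z.1 z.2 := hV.continuous
  have c2 : Continuous fun z : ℝ × ℝ => pX F z.1 z.2 := hX.continuous
  have c3 : Continuous fun z : ℝ × ℝ => pV (pX F) z.1 z.2 := hXV
  have hcont : Continuous fun z : ℝ × ℝ => 4 * (‖F z.1 z.2‖ ^ 2 +
      ‖pV F z.1 z.2‖ ^ 2 + ‖pX F z.1 z.2‖ ^ 2 + ‖pV (pX F) z.1 z.2‖ ^ 2) := by fun_prop
  have hslice : ∀ {G : ℝ → ℝ → ℂ}, ContDiff ℝ 1 (Function.uncurry G) →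
      Continuous (fun z : ℝ × ℝ => pV G z.1 z.2) → ∀ y : ℝ, ENNReal.ofReal (‖G y v‖ ^ 2) ≤
      ∫⁻ w in Ioc v (v + 1), ENNReal.ofReal (2 * (‖G y w‖ ^ 2 + ‖pV G y w‖ ^ 2)) := by
    intro G hG hGc y
    exact ofReal_sq_norm_le_lintegral (φ := fun w => G y w) (φ' := fun w => pV G y w)
      (fun w => hasDerivAt_pV hG y w) (hGc.comp (continuous_const.prodMk continuous_id))
      (by simp) ⟨le_rfl, by linarith⟩
  rw [hxy, μTR, lintegral_prod _ (by fun_prop)]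
  refine (ofReal_sq_norm_le_lintegral (φ := fun y => F y v) (φ' := fun y => pX F y v)
    (a := 0) (b := 2 * π) (fun w => hasDerivAt_pX hF1 w v)
    (c2.comp (continuous_id.prodMk continuous_const)) (by nlinarith [Real.pi_gt_three])
    ⟨hy.1.le, by simpa using hy.2⟩).trans ?_
  refine lintegral_mono fun y => ?_
  have e : ENNReal.ofReal (2 * (‖F y v‖ ^ 2 + ‖pX F y v‖ ^ 2)) =
      2 * (ENNReal.ofReal (‖F y v‖ ^ 2) + ENNReal.ofReal (‖pX F y v‖ ^ 2)) := by
    rw [ENNReal.ofReal_mul (by norm_num), ENNReal.ofReal_add (by positivity) (by positivity)]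
    simp
  have m1 : Measurable fun w => ENNReal.ofReal (2 * (‖F y w‖ ^ 2 + ‖pV F y w‖ ^ 2)) := by
    have a := c0.comp (continuous_const.prodMk continuous_id : Continuous fun w : ℝ => (y, w))
    have b := c1.comp (continuous_const.prodMk continuous_id : Continuous fun w : ℝ => (y, w))
    simp only [Function.comp_def] at a b
    fun_prop
  calc _ = _ := e
    _ ≤ 2 * ((∫⁻ w in Ioc v (v + 1), ENNReal.ofReal (2 * (‖F y w‖ ^ 2 + ‖pV F y w‖ ^ 2))) +
        ∫⁻ w in Ioc v (v + 1), ENNReal.ofReal (2 * (‖pX F y w‖ ^ 2 + ‖pV (pX F) y w‖ ^ 2))) := by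
        gcongr
        · exact hslice hF1 c1 y
        · exact hslice hX c3 y
    _ = ∫⁻ w in Ioc v (v + 1), ENNReal.ofReal (4 * (‖F y w‖ ^ 2 +
      ‖pV F y w‖ ^ 2 + ‖pX F y w‖ ^ 2 + ‖pV (pX F) y w‖ ^ 2)) := by
        rw [← lintegral_add_left m1, ← lintegral_const_mul' _ _ (by simp)]
        refine lintegral_congr fun w => ?_
        rw [← ENNReal.ofReal_add (by positivity) (by positivity),
          show (2 : ENNReal) = ENNReal.ofReal 2 by simp, ← ENNReal.ofReal_mul (by norm_num)]
        congr 1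
        ring
    _ ≤ _ := setLIntegral_le_lintegral _ _

lemma periodic_pX {f : ℝ → ℝ → ℂ} {c : ℝ} (hf : ∀ v, Function.Periodic (fun x => f x v) c)
    (v : ℝ) : Function.Periodic (fun x => pX f x v) c := by
  intro x
  change deriv (fun x' => f x' v) (x + c) = deriv (fun x' => f x' v) x
  rw [← deriv_comp_add_const]
  congr 1
  funext y
  exact hf v y

lemma periodic_pV {f : ℝ → ℝ → ℂ} {c : ℝ} (hf : ∀ v, Function.Periodic (fun x => f x v) c)
    (v : ℝ) : Function.Periodic (fun x => pV f x v) c := by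
  intro x
  change deriv (fun v' => f (x + c) v') v = deriv (fun v' => f x v') v
  congr 1
  funext y
  exact hf y x

lemma periodic_dXV {f : ℝ → ℝ → ℂ} {c : ℝ} (hf : ∀ v, Function.Periodic (fun x => f x v) c)
    (p q : ℕ) : ∀ v, Function.Periodic (fun x => dXV p q f x v) c := by
  have hV : ∀ v, Function.Periodic (fun x => pV^[q] f x v) c := by
    induction q with
    | zero => exact hf
    | succ q ih => simp only [Function.iterate_succ_apply']; exact periodic_pV ih
  induction p with
  | zero => exact hV
  | succ p ih => rw [← pX_dXV]; exact periodic_pX ih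

lemma norm_dXV_le_Hnorm {m0 : ℝ} (hm0 : 0 ≤ m0) {n a b : ℕ} (hab : a + b + 2 ≤ n)
    {f : ℝ → ℝ → ℂ} (hf : MemH m0 n f) (x v : ℝ) : ‖dXV a b f x v‖ ≤ 4 * Hnorm m0 n f := by
  obtain ⟨hc, hper, hint⟩ := hf
  have hF : ContDiff ℝ 2 (Function.uncurry (dXV a b f)) :=
    contDiff_dXV (n := 2) (hc.of_le (by norm_cast; omega))
  have hV : pV (dXV a b f) = dXV a (b + 1) f := pV_dXV (hc.of_le (by norm_cast; omega))
  have hXV : pV (dXV (a + 1) b f) = dXV (a + 1) (b + 1) f :=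
    pV_dXV (hc.of_le (by norm_cast; omega))
  have h := ofReal_sq_norm_le_lintegral_prod hF (periodic_dXV hper a b) x v
  rw [hV, pX_dXV, hXV] at h
  have i1 := hint a b (by omega)
  have i2 := hint a (b + 1) (by omega)
  have i3 := hint (a + 1) b (by omega)
  have i4 := hint (a + 1) (b + 1) (by omega)
  have j2 : Integrable (fun z => wInt m0 a b f z + wInt m0 a (b + 1) f z) μTR := i1.add i2
  have j3 : Integrable (fun z => wInt m0 a b f z + wInt m0 a (b + 1) f z +
      wInt m0 (a + 1) b f z) μTR := j2.add i3
  have j4 : Integrable (fun z => wInt m0 a b f z + wInt m0 a (b + 1) f z +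
      wInt m0 (a + 1) b f z + wInt m0 (a + 1) (b + 1) f z) μTR := j3.add i4
  have hle : ENNReal.ofReal (‖dXV a b f x v‖ ^ 2) ≤ ENNReal.ofReal ((4 * Hnorm m0 n f) ^ 2) := by
    refine h.trans ?_
    calc _ ≤ ∫⁻ z, ENNReal.ofReal (4 * (wInt m0 a b f z + wInt m0 a (b + 1) f z +
          wInt m0 (a + 1) b f z + wInt m0 (a + 1) (b + 1) f z)) ∂μTR := by
          refine lintegral_mono fun z => ENNReal.ofReal_le_ofReal ?_
          gcongr <;> exact sq_norm_le_wInt hm0 _ _ _ _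
      _ = ENNReal.ofReal (∫ z, 4 * (wInt m0 a b f z + wInt m0 a (b + 1) f z +
          wInt m0 (a + 1) b f z + wInt m0 (a + 1) (b + 1) f z) ∂μTR) := by
          rw [ofReal_integral_eq_lintegral_ofReal (j4.const_mul 4)]
          refine Filter.Eventually.of_forall fun z => ?_
          have := wInt_nonneg m0 a b f z
          have := wInt_nonneg m0 a (b + 1) f z
          have := wInt_nonneg m0 (a + 1) b f z
          have := wInt_nonneg m0 (a + 1) (b + 1) f z
          simp only [Pi.zero_apply]
          positivity
      _ ≤ _ := by
          refine ENNReal.ofReal_le_ofReal ?_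
          rw [integral_const_mul, integral_add j3 i4,
            integral_add j2 i3, integral_add i1 i2, mul_pow, sq_Hnorm]
          have := integral_wInt_le_HnormSq m0 (p := a) (q := b) (n := n) (by omega) f
          have := integral_wInt_le_HnormSq m0 (p := a) (q := b + 1) (n := n) (by omega) f
          have := integral_wInt_le_HnormSq m0 (p := a + 1) (q := b) (n := n) (by omega) f
          have := integral_wInt_le_HnormSq m0 (p := a + 1) (q := b + 1) (n := n) (by omega) f
          linarith
  rw [ENNReal.ofReal_le_ofReal_iff (by positivity)] at hle
  exact le_of_sq_le_sq hle (by have := Hnorm_nonneg m0 n f; positivity)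

lemma integrable_inv_weight {m0 : ℝ} (hm0 : 1 / 2 < m0) :
    Integrable (fun z : ℝ × ℝ => ((1 + z.2 ^ 2) ^ m0)⁻¹) μTR := by
  have h : Integrable (fun v : ℝ => ((1 + ‖v‖ ^ 2) : ℝ) ^ (-(2 * m0) / 2)) volume :=
    integrable_rpow_neg_one_add_norm_sq (by simp; linarith)
  have h2 : Integrable (fun v : ℝ => ((1 + v ^ 2) ^ m0)⁻¹) volume := by
    refine h.congr (Filter.Eventually.of_forall fun v => ?_)
    simp only [Real.norm_eq_abs, sq_abs]
    rw [show -(2 * m0) / 2 = -m0 by ring, Real.rpow_neg (by positivity)]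
  have h1 : Integrable (fun _ : ℝ => (1 : ℝ)) (volume.restrict (Set.Ioc 0 (2 * π))) := by simp
  simpa [μTR] using h1.mul_prod h2

lemma MemH.integrable {m0 : ℝ} (hm0 : 1 / 2 < m0) {n : ℕ} {f : ℝ → ℝ → ℂ} (hf : MemH m0 n f) :
    Integrable (fun z : ℝ × ℝ => f z.1 z.2) μTR := by
  refine ((hf.2.2 0 0 (Nat.zero_le _)).add (integrable_inv_weight hm0)).mono'
    hf.1.continuous.aestronglyMeasurable (Filter.Eventually.of_forall fun z => ?_)
  have hw := weight_pos m0 z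
  simp only [Pi.add_apply, wInt, Function.iterate_zero, id]
  set w := (1 + z.2 ^ 2) ^ m0
  set y := ‖f z.1 z.2‖
  have : w * w⁻¹ = 1 := mul_inv_cancel₀ hw.ne'
  have hwi : 0 < w⁻¹ := inv_pos.2 hw
  have h1 : w * y ^ 2 + w⁻¹ - 2 * y = w * (y - w⁻¹) ^ 2 := by
    linear_combination (2 * y - w⁻¹) * this
  have h2 : 0 ≤ w * (y - w⁻¹) ^ 2 := by positivity
  have h3 : 0 ≤ y := norm_nonneg _
  linarith

lemma Qle.bounds {m0 R t : ℝ} {s : ℕ} {g : ℝ → ℝ → ℝ → ℂ} (ht : 0 ≤ t) (hQ : Qle m0 s g t R) :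
    Hnorm m0 s (g t) ≤ R * jap t ^ 3 ∧
    (∀ k : ℤ, k = 1 ∨ k = -1 → jap t ^ (s - 1) * ‖zeta g k t‖ ≤ R) ∧
    Hnorm m0 (s - 4) (g t) ≤ R := by
  obtain ⟨A, B, C, hABC, hA, hB, hC⟩ := hQ
  have hmem : t ∈ Icc (0 : ℝ) t := ⟨ht, le_rfl⟩
  have hJ := jap_pos t
  have hA0 : 0 ≤ A := le_trans (div_nonneg (Hnorm_nonneg _ _ _) (by positivity)) (hA t hmem)
  have hB0 : 0 ≤ B := le_trans (by positivity) (hB t hmem 1 (Or.inl rfl))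
  have hC0 : 0 ≤ C := le_trans (Hnorm_nonneg _ _ _) (hC t hmem)
  refine ⟨?_, fun k hk => (hB t hmem k hk).trans (by linarith), (hC t hmem).trans (by linarith)⟩
  rw [← div_le_iff₀ (by positivity)]
  exact (hA t hmem).trans (by linarith)

lemma dXV_totalState {ε : ℝ} {η : ℝ → ℂ} {g : ℝ → ℝ → ℝ → ℂ} {a b : ℕ}
    (hη : ContDiff ℝ (a + b : ℕ) (Function.uncurry fun _ : ℝ => η)) (hg : SmoothG g)
    (t x v : ℝ) : dXV a b (totalState ε η g t) x v =
      dXV a b (fun _ w => η w) x v + ε * dXV a b (g t) x v := by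
  unfold totalState
  rw [dXV_add_mul 1 (ε : ℂ) hη (hg.contDiff_slice _ t), one_mul]

lemma norm_dXV_pT_le_of_le {ε R T : ℝ} {η : ℝ → ℂ} {g : ℝ → ℝ → ℝ → ℂ} {p q s : ℕ} (hs : 2 ≤ s)
    (hpq : p + q ≤ s) {t : ℝ} (hη : ContDiff ℝ (p + q + 1 : ℕ) (Function.uncurry fun _ : ℝ => η))
    (hg : SmoothG g) (hsol : IsVHMF ε η g) (hgi : Integrable (fun z : ℝ × ℝ => g t z.1 z.2) μTR)
    (hz : ∀ k : ℤ, k = 1 ∨ k = -1 → jap t ^ (s - 1) * ‖zeta g k t‖ ≤ R) (x v : ℝ)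
    (hT : ∀ a b l : ℕ, l ≤ p + q → a + b = l + 1 →
      jap t ^ (p + q - l) * ‖dXV a b (totalState ε η g t) x v‖ ≤ T) :
    jap t ^ (s - 2) * ‖dXV p q (pT g t) x v‖ ≤
      (2 * (π * R * ((s + 1) * ((s + 1) * (2 ^ s * 2 ^ s * 2))))) * T := by
  have hJ := jap_pos t
  have hR : 0 ≤ R := le_trans (by positivity) (hz 1 (Or.inl rfl))
  have hT0 : 0 ≤ T := le_trans (by positivity) (hT 1 0 0 (Nat.zero_le _) rfl)
  refine (norm_dXV_pT_le hs hη hg hsol hgi hz x v hT).trans ?_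
  have hp : (p : ℝ) ≤ s := by exact_mod_cast (by omega : p ≤ s)
  have hq : (q : ℝ) ≤ s := by exact_mod_cast (by omega : q ≤ s)
  have hp2 : (2 : ℝ) ^ p ≤ 2 ^ s := pow_le_pow_right₀ (by norm_num) (by omega)
  have hq2 : (2 : ℝ) ^ q ≤ 2 ^ s := pow_le_pow_right₀ (by norm_num) (by omega)
  gcongr

lemma jap_le_one_add {t : ℝ} (ht : 0 ≤ t) : jap t ≤ 1 + t :=
  (Real.sqrt_le_left (by linarith)).2 (by nlinarith)

/-- Growing derivative bounds improve to an integrable decay of the time derivative. -/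
lemma exists_norm_dXV_pT_le {ε R C : ℝ} {η : ℝ → ℂ} {g : ℝ → ℝ → ℝ → ℂ} {s : ℕ} (hs : 7 ≤ s)
    (hη : ContDiff ℝ s (Function.uncurry fun _ : ℝ => η)) (hg : SmoothG g) (hsol : IsVHMF ε η g)
    (hε : 0 ≤ ε) (hgi : ∀ t, Integrable (fun z : ℝ × ℝ => g t z.1 z.2) μTR)
    (hz : ∀ t, 0 ≤ t → ∀ k : ℤ, k = 1 ∨ k = -1 → jap t ^ (s - 1) * ‖zeta g k t‖ ≤ R)
    (hC : ∀ a b, a + b ≤ s - 3 → ∀ x v, ‖dXV a b (fun _ w => η w) x v‖ ≤ C)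
    (h1 : ∀ a b, a + b = 1 → ∀ t, 0 ≤ t → ∀ x v, ‖dXV a b (g t) x v‖ ≤ C)
    (h3 : ∀ a b, a + b ≤ s - 3 → ∀ t, 0 ≤ t → ∀ x v, ‖dXV a b (g t) x v‖ ≤ C * jap t ^ 3) :
    ∃ M : ℝ, ∀ p q, p + q ≤ s - 4 → ∀ t, 0 ≤ t → ∀ x v,
      jap t ^ 2 * ‖dXV p q (pT g t) x v‖ ≤ M := by
  have hC0 : 0 ≤ C := (norm_nonneg _).trans (hC 0 0 (by omega) 0 0)
  have hR : 0 ≤ R := le_trans (by have := jap_pos 0; positivity) (hz 0 le_rfl 1 (Or.inl rfl))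
  set K : ℝ := 2 * (π * R * ((s + 1) * ((s + 1) * (2 ^ s * 2 ^ s * 2)))) with hK
  have hK0 : 0 ≤ K := by positivity
  have htot : ∀ {a b : ℕ} {D t : ℝ} {x v : ℝ}, a + b ≤ s - 3 → ‖dXV a b (g t) x v‖ ≤ D →
      ‖dXV a b (totalState ε η g t) x v‖ ≤ C + ε * D := by
    intro a b D t x v hab hD
    rw [dXV_totalState (hη.of_le (by exact_mod_cast (by omega : a + b ≤ s))) hg]
    refine (norm_add_le _ _).trans (add_le_add (hC a b hab x v) ?_)
    rw [norm_mul, Complex.norm_real, Real.norm_eq_abs, abs_of_nonneg hε]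
    gcongr
  have happ : ∀ {p q : ℕ} {t T x v : ℝ}, p + q ≤ s - 4 → 0 ≤ t →
      (∀ a b l : ℕ, l ≤ p + q → a + b = l + 1 →
      jap t ^ (p + q - l) * ‖dXV a b (totalState ε η g t) x v‖ ≤ T) →
      jap t ^ (s - 2) * ‖dXV p q (pT g t) x v‖ ≤ K * T := by
    intro p q t T x v hpq ht hT
    exact norm_dXV_pT_le_of_le (by omega) (by omega)
      (hη.of_le (by exact_mod_cast (by omega : p + q + 1 ≤ s))) hg hsol (hgi t) (hz t ht) x v hT
  have hbdd : ∀ p q, p + q ≤ s - 4 → ∀ t, 0 ≤ t → ∀ x v,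
      ‖dXV p q (pT g t) x v‖ ≤ K * (C + ε * C) := by
    intro p q hpq t ht x v
    have hJ := one_le_jap t
    have hJ0 := jap_pos t
    have h := happ (p := p) (q := q) (x := x) (v := v) (T := (C + ε * C) * jap t ^ (s - 2)) hpq ht ?_
    · have hp : 0 < jap t ^ (s - 2) := by positivity
      refine le_of_mul_le_mul_left (h.trans_eq ?_) hp
      ring
    intro a b l hl hab
    rcases Nat.eq_zero_or_pos l with rfl | hl0
    · calc _ ≤ jap t ^ (s - 2) * (C + ε * C) := mul_le_mul
            (pow_le_pow_right₀ hJ (by omega)) (htot (by omega) (h1 a b (by omega) t ht x v))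
            (norm_nonneg _) (by positivity)
        _ = _ := by ring
    · have hCJ : C ≤ C * jap t ^ 3 := le_mul_of_one_le_right hC0 (one_le_pow₀ hJ)
      calc _ ≤ jap t ^ (p + q - l) * (C * jap t ^ 3 + ε * (C * jap t ^ 3)) := by
            gcongr
            exact (htot (by omega) (h3 a b (by omega) t ht x v)).trans (by linarith)
        _ = (C + ε * C) * jap t ^ (p + q - l + 3) := by ring
        _ ≤ _ := by
            gcongr
            omega
  have growth : ∀ a b, a + b ≤ s - 4 → ∀ t, 0 ≤ t → ∀ x v,
      ‖dXV a b (g t) x v‖ ≤ (C + K * (C + ε * C)) * jap t := by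
    intro a b hab t ht x v
    have hJ := one_le_jap t
    have hd := norm_image_sub_le_of_norm_deriv_le_segment' (a := 0) (b := t)
      (f := fun τ => dXV a b (g τ) x v) (f' := fun τ => dXV a b (pT g τ) x v)
      (C := K * (C + ε * C))
      (fun τ _ => (hg.hasDerivAt_dXV a b τ x v).hasDerivWithinAt)
      (fun τ hτ => hbdd a b hab τ hτ.1 x v) t ⟨ht, le_rfl⟩
    have h0 := h3 a b (by omega) 0 le_rfl x v
    have hj0 : jap 0 = 1 := by simp [jap]
    rw [hj0, one_pow, mul_one] at h0
    have htJ : t ≤ jap t := (le_abs_self t).trans (abs_le_jap t)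
    have hM0 : 0 ≤ K * (C + ε * C) := by positivity
    calc _ = ‖dXV a b (g 0) x v + (dXV a b (g t) x v - dXV a b (g 0) x v)‖ := by
          congr 1; ring
      _ ≤ C + K * (C + ε * C) * (t - 0) := (norm_add_le _ _).trans (add_le_add h0 hd)
      _ ≤ C * jap t + K * (C + ε * C) * jap t := by
          rw [sub_zero]
          gcongr
          exact le_mul_of_one_le_right hC0 hJ
      _ = _ := by ring
  set L : ℝ := C + K * (C + ε * C) with hL
  have hLC : C ≤ L := le_add_of_nonneg_right (by positivity)
  have hL0 : 0 ≤ L := hC0.trans hLC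
  refine ⟨K * (L + ε * L), fun p q hpq t ht x v => ?_⟩
  have hJ := one_le_jap t
  have hJ0 := jap_pos t
  have h := happ (p := p) (q := q) (x := x) (v := v) (T := (L + ε * L) * jap t ^ (s - 4)) hpq ht ?_
  · have hp : 0 < jap t ^ (s - 4) := by positivity
    refine le_of_mul_le_mul_left ?_ hp
    calc _ = jap t ^ (s - 2) * ‖dXV p q (pT g t) x v‖ := by
          rw [← mul_assoc, ← pow_add]; congr 2; omega
      _ ≤ _ := h.trans_eq (by ring)
  intro a b l hl hab
  have step : ∀ e : ℕ, p + q - l + e ≤ s - 4 → ‖dXV a b (g t) x v‖ ≤ L * jap t ^ e →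
      jap t ^ (p + q - l) * ‖dXV a b (totalState ε η g t) x v‖
        ≤ (L + ε * L) * jap t ^ (s - 4) := by
    intro e he hb
    have hCJ : C ≤ L * jap t ^ e := hLC.trans (le_mul_of_one_le_right hL0 (one_le_pow₀ hJ))
    calc _ ≤ jap t ^ (p + q - l) * (L * jap t ^ e + ε * (L * jap t ^ e)) := by
          gcongr
          exact (htot (by omega) hb).trans (by linarith)
      _ = (L + ε * L) * jap t ^ (p + q - l + e) := by ring
      _ ≤ _ := by
          gcongr
  rcases Nat.eq_zero_or_pos l with rfl | hl0
  · exact step 0 (by omega) (by simpa using (h1 a b (by omega) t ht x v).trans hLC)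
  · by_cases hab4 : a + b ≤ s - 4
    · exact step 1 (by omega) (by simpa using growth a b hab4 t ht x v)
    · exact step 3 (by omega) ((h3 a b (by omega) t ht x v).trans (by gcongr))

lemma tail_integral_le {t : ℝ} (ht : 0 ≤ t) : ∫ τ in Ioi t, (1 + τ ^ 2)⁻¹ ≤ 4 / jap t := by
  rw [integral_Ioi_inv_one_add_sq, le_div_iff₀ (jap_pos t)]
  have hJ := jap_le_one_add ht
  have hJ0 := jap_pos t
  rcases le_or_gt 1 t with h | h
  · have h0 : 0 < t := by linarith
    rw [← Real.arctan_inv_of_pos h0]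
    have h1 : Real.arctan t⁻¹ ≤ t⁻¹ := by
      have h2 : 0 ≤ t⁻¹ := by positivity
      simpa [Real.tan_arctan] using
        Real.le_tan (Real.arctan_nonneg.2 h2) (Real.arctan_lt_pi_div_two t⁻¹)
    calc _ ≤ t⁻¹ * (1 + t) := by gcongr
      _ = t⁻¹ + 1 := by field_simp
      _ ≤ 1 + 1 := by gcongr; exact inv_le_one_of_one_le₀ h
      _ ≤ 4 := by norm_num
  · have h1 : 0 ≤ Real.arctan t := Real.arctan_nonneg.2 ht
    nlinarith [Real.pi_lt_four]

lemma exists_tendsto_of_norm_deriv_le {f f' : ℝ → ℂ} {M : ℝ} (hf : ∀ t, HasDerivAt f (f' t) t)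
    (hc : Continuous f') (hM : ∀ t, 0 ≤ t → jap t ^ 2 * ‖f' t‖ ≤ M) :
    ∃ a, Filter.Tendsto f Filter.atTop (nhds a) ∧
      ∀ t, 0 ≤ t → ‖f t - a‖ ≤ ∫ τ in Ioi t, ‖f' τ‖ := by
  have hint : ∀ t, 0 ≤ t → IntegrableOn f' (Ioi t) := by
    intro t ht
    refine Integrable.mono' ((integrable_inv_one_add_sq.const_mul M).integrableOn (s := Ioi t))
      hc.aestronglyMeasurable ?_
    filter_upwards [ae_restrict_mem measurableSet_Ioi] with τ hτ
    rw [← jap_sq, ← div_eq_mul_inv, le_div_iff₀ (by have := jap_pos τ; positivity), mul_comm]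
    exact hM τ (ht.trans (le_of_lt hτ))
  have hlim := tendsto_limUnder_of_hasDerivAt_of_integrableOn_Ioi (a := 0)
    (fun x _ => hf x) (hint 0 le_rfl)
  refine ⟨_, hlim, fun t ht => ?_⟩
  rw [norm_sub_rev, ← integral_Ioi_of_hasDerivAt_of_tendsto' (fun x _ => hf x) (hint t ht) hlim]
  exact norm_integral_le_integral_norm _

/-- The real-linear map on the plane with partial derivatives `a` and `b`. -/
def gradMap (a b : ℂ) : ℝ × ℝ →L[ℝ] ℂ :=
  ContinuousLinearMap.smulRightL ℝ (ℝ × ℝ) ℂ (ContinuousLinearMap.fst ℝ ℝ ℝ) a +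
    ContinuousLinearMap.smulRightL ℝ (ℝ × ℝ) ℂ (ContinuousLinearMap.snd ℝ ℝ ℝ) b

lemma gradMap_apply (a b : ℂ) (z : ℝ × ℝ) : gradMap a b z = z.1 • a + z.2 • b := rfl

lemma hasFDerivAt_gradMap {f : ℝ → ℝ → ℂ} (hf : ContDiff ℝ 1 (Function.uncurry f)) (z : ℝ × ℝ) :
    HasFDerivAt (Function.uncurry f) (gradMap (pX f z.1 z.2) (pV f z.1 z.2)) z := by
  convert! ((hf.differentiable one_ne_zero) z).hasFDerivAt using 1
  rw [pX_eq_fderiv hf, pV_eq_fderiv hf]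
  refine ContinuousLinearMap.ext fun w => ?_
  rw [gradMap_apply, ← map_smul, ← map_smul, ← map_add]
  simp

lemma ContDiff.gradMap {E : Type*} [NormedAddCommGroup E] [NormedSpace ℝ E] {n : ℕ} {a b : E → ℂ}
    (ha : ContDiff ℝ n a) (hb : ContDiff ℝ n b) : ContDiff ℝ n fun z => gradMap (a z) (b z) :=
  ((ContinuousLinearMap.contDiff _).comp ha).add ((ContinuousLinearMap.contDiff _).comp hb)

lemma TendstoUniformly.gradMap {ι E : Type*} {l : Filter ι} {F G : ι → E → ℂ} {a b : E → ℂ}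
    (ha : TendstoUniformly F a l) (hb : TendstoUniformly G b l) :
    TendstoUniformly (fun i z => gradMap (F i z) (G i z)) (fun z => gradMap (a z) (b z)) l :=
  ((ContinuousLinearMap.uniformContinuous _).comp_tendstoUniformly ha).add
    ((ContinuousLinearMap.uniformContinuous _).comp_tendstoUniformly hb)

lemma pX_eq_of_hasFDerivAt {f : ℝ → ℝ → ℂ} {a b : ℂ} {x v : ℝ}
    (h : HasFDerivAt (fun z : ℝ × ℝ => f z.1 z.2) (gradMap a b) (x, v)) : pX f x v = a := by
  have hl : HasDerivAt (fun x' : ℝ => (x', v)) ((1 : ℝ), (0 : ℝ)) x :=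
    (hasDerivAt_id x).prodMk (hasDerivAt_const x v)
  have := h.comp_hasDerivAt x hl
  exact this.deriv.trans (by simp [gradMap_apply])

lemma pV_eq_of_hasFDerivAt {f : ℝ → ℝ → ℂ} {a b : ℂ} {x v : ℝ}
    (h : HasFDerivAt (fun z : ℝ × ℝ => f z.1 z.2) (gradMap a b) (x, v)) : pV f x v = b := by
  have hl : HasDerivAt (fun v' : ℝ => (x, v')) ((0 : ℝ), (1 : ℝ)) v :=
    (hasDerivAt_const v x).prodMk (hasDerivAt_id v)
  have := h.comp_hasDerivAt v hl
  exact this.deriv.trans (by simp [gradMap_apply])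

/-- A compatible family of candidates for the partial derivatives comes from its first member. -/
lemma contDiff_of_hasFDerivAt_family {n : ℕ} {a : ℕ → ℕ → ℝ → ℝ → ℂ}
    (hc : ∀ p q, p + q ≤ n → Continuous fun z : ℝ × ℝ => a p q z.1 z.2)
    (hd : ∀ p q, p + q + 1 ≤ n → ∀ z : ℝ × ℝ, HasFDerivAt (fun z : ℝ × ℝ => a p q z.1 z.2)
      (gradMap (a (p + 1) q z.1 z.2) (a p (q + 1) z.1 z.2)) z) :
    ContDiff ℝ n (Function.uncurry (a 0 0)) ∧
      ∀ p q, p + q ≤ n → dXV p q (a 0 0) = a p q := by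
  have hcd : ∀ k p q, p + q + k ≤ n → ContDiff ℝ k fun z : ℝ × ℝ => a p q z.1 z.2 := by
    intro k
    induction k with
    | zero => intro p q h; exact contDiff_zero.2 (hc p q h)
    | succ k ih =>
      intro p q h
      push_cast
      exact contDiff_succ_iff_hasFDerivAt.2 ⟨_, (ih (p + 1) q (by omega)).gradMap
        (ih p (q + 1) (by omega)), hd p q (by omega)⟩
  refine ⟨hcd n 0 0 (by omega), ?_⟩
  have hV : ∀ q, q ≤ n → pV^[q] (a 0 0) = a 0 q := by
    intro q
    induction q with
    | zero => intro _; rfl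
    | succ q ih =>
      intro h
      rw [Function.iterate_succ_apply', ih (by omega)]
      funext x v
      exact pV_eq_of_hasFDerivAt (hd 0 q (by omega) (x, v))
  intro p q
  induction p with
  | zero => intro h; exact hV q (by omega)
  | succ p ih =>
    intro h
    rw [← pX_dXV, ih (by omega)]
    funext x v
    exact pX_eq_of_hasFDerivAt (hd p q (by omega) (x, v))

lemma tendsto_jap_atTop : Filter.Tendsto jap Filter.atTop Filter.atTop :=
  Filter.tendsto_atTop_mono (fun t => (le_abs_self t).trans (abs_le_jap t)) Filter.tendsto_id

lemma SmoothG.continuous_time {G : ℝ → ℝ → ℝ → ℂ} (hG : SmoothG G) (x v : ℝ) :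
    Continuous fun t => G t x v :=
  (hG 0).continuous.comp (by fun_prop : Continuous fun t : ℝ => (t, x, v))

lemma setIntegral_norm_le_div_jap {f : ℝ → ℂ} {M : ℝ}
    (hM : ∀ t, 0 ≤ t → jap t ^ 2 * ‖f t‖ ≤ M) {t : ℝ} (ht : 0 ≤ t) :
    ∫ τ in Ioi t, ‖f τ‖ ≤ M * (4 / jap t) := by
  have hM0 : 0 ≤ M := le_trans (by positivity) (hM 0 le_rfl)
  calc _ ≤ ∫ τ in Ioi t, M * (1 + τ ^ 2)⁻¹ := by
        refine integral_mono_of_nonneg (Filter.Eventually.of_forall fun _ => norm_nonneg _)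
          ((integrable_inv_one_add_sq.const_mul M).integrableOn) ?_
        filter_upwards [ae_restrict_mem measurableSet_Ioi] with τ hτ
        rw [← jap_sq, ← div_eq_mul_inv, le_div_iff₀ (by have := jap_pos τ; positivity), mul_comm]
        exact hM τ (ht.trans (le_of_lt hτ))
    _ ≤ _ := by
        rw [integral_const_mul]
        exact mul_le_mul_of_nonneg_left (tail_integral_le ht) hM0

lemma exists_limit_profile {n : ℕ} {g : ℝ → ℝ → ℝ → ℂ} {M : ℝ} (hg : SmoothG g)
    (hM : ∀ p q, p + q ≤ n → ∀ t, 0 ≤ t → ∀ x v, jap t ^ 2 * ‖dXV p q (pT g t) x v‖ ≤ M) :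
    ∃ ginf : ℝ → ℝ → ℂ, ContDiff ℝ n (Function.uncurry ginf) ∧
      ∀ p q, p + q ≤ n → ∀ x v,
        Filter.Tendsto (fun t => dXV p q (g t) x v) Filter.atTop (nhds (dXV p q ginf x v)) ∧
        ∀ t, 0 ≤ t → ‖dXV p q (g t) x v - dXV p q ginf x v‖ ≤
          ∫ τ in Ioi t, ‖dXV p q (pT g τ) x v‖ := by
  have key : ∀ p q x v, ∃ a : ℂ, p + q ≤ n →
      Filter.Tendsto (fun t => dXV p q (g t) x v) Filter.atTop (nhds a) ∧
      ∀ t, 0 ≤ t → ‖dXV p q (g t) x v - a‖ ≤ ∫ τ in Ioi t, ‖dXV p q (pT g τ) x v‖ := by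
    intro p q x v
    by_cases h : p + q ≤ n
    · obtain ⟨a, ha⟩ := exists_tendsto_of_norm_deriv_le
        (fun t => hg.hasDerivAt_dXV p q t x v) ((hg.pT.dXV p q).continuous_time x v)
        (fun t ht => hM p q h t ht x v)
      exact ⟨a, fun _ => ha⟩
    · exact ⟨0, fun h' => absurd h' h⟩
  choose a ha using key
  have hu : ∀ p q, p + q ≤ n → TendstoUniformly (fun t (z : ℝ × ℝ) => dXV p q (g t) z.1 z.2)
      (fun z => a p q z.1 z.2) Filter.atTop := by
    intro p q h
    rw [Metric.tendstoUniformly_iff]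
    intro δ hδ
    have hlim : Filter.Tendsto (fun t => M * (4 / jap t)) Filter.atTop (nhds 0) := by
      simpa using (tendsto_jap_atTop.const_div_atTop 4).const_mul M
    filter_upwards [hlim.eventually_lt_const hδ, Filter.eventually_ge_atTop 0] with t h1 h2 z
    rw [dist_comm, dist_eq_norm]
    exact (((ha p q z.1 z.2 h).2 t h2).trans (setIntegral_norm_le_div_jap
      (fun τ hτ => hM p q h τ hτ z.1 z.2) h2)).trans_lt h1
  have hs : ∀ p q t, ContDiff ℝ 1 (Function.uncurry (dXV p q (g t))) := fun p q t =>
    contDiff_dXV (n := 1) (hg.contDiff_slice _ t)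
  obtain ⟨h1, h2⟩ := contDiff_of_hasFDerivAt_family (n := n) (a := a)
    (fun p q h => (hu p q h).continuous
      (Filter.Eventually.frequently (Filter.Eventually.of_forall fun t => (hs p q t).continuous)))
    (fun p q h z => by
      refine hasFDerivAt_of_tendstoUniformly
        ((hu (p + 1) q (by omega)).gradMap (hu p (q + 1) (by omega)))
        (fun t z => ?_) (fun z => (ha p q z.1 z.2 (by omega)).1) z
      have := hasFDerivAt_gradMap (hs p q t) z
      rwa [pX_dXV, pV_dXV (hg.contDiff_slice _ t)] at this)
  refine ⟨a 0 0, h1, fun p q h x v => ?_⟩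
  rw [h2 p q h]
  exact ha p q x v h

lemma lintegral_ofReal_le_of_le {α : Type*} [MeasurableSpace α] {μ : Measure α} {f F : α → ℝ}
    {B : ℝ} (hfF : ∀ z, f z ≤ F z) (hF0 : ∀ z, 0 ≤ F z) (hF : Integrable F μ)
    (hB : ∫ z, F z ∂μ ≤ B) : ∫⁻ z, ENNReal.ofReal (f z) ∂μ ≤ ENNReal.ofReal B := by
  refine (lintegral_mono fun z => ENNReal.ofReal_le_ofReal (hfF z)).trans ?_
  rw [← ofReal_integral_eq_lintegral_ofReal hF (Filter.Eventually.of_forall hF0)]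
  exact ENNReal.ofReal_le_ofReal hB

lemma sq_norm_add_mul_le (ε : ℝ) (a b : ℂ) : ‖a + ε * b‖ ^ 2 ≤ 2 * (‖a‖ ^ 2 + ε ^ 2 * ‖b‖ ^ 2) := by
  have h := norm_add_le a (ε * b)
  have hn : ‖(ε * b : ℂ)‖ ^ 2 = ε ^ 2 * ‖b‖ ^ 2 := by
    rw [norm_mul, mul_pow, Complex.norm_real, Real.norm_eq_abs, sq_abs]
  rw [← hn]
  nlinarith [norm_nonneg (a + ε * b), norm_nonneg a, norm_nonneg (ε * b : ℂ),
    sq_nonneg (‖a‖ - ‖(ε * b : ℂ)‖)]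

/-- Weighted mean-square decay of the derivatives of the time derivative. -/
lemma lintegral_wInt_pT_le {m0 ε R E : ℝ} {η : ℝ → ℂ} {g : ℝ → ℝ → ℝ → ℂ} {s p q : ℕ}
    (hs : 7 ≤ s) (hpq : p + q ≤ s - 4) {t : ℝ}
    (hη : ContDiff ℝ s (Function.uncurry fun _ : ℝ => η)) (hg : SmoothG g) (hsol : IsVHMF ε η g)
    (hgi : Integrable (fun z : ℝ × ℝ => g t z.1 z.2) μTR)
    (hz : ∀ k : ℤ, k = 1 ∨ k = -1 → jap t ^ (s - 1) * ‖zeta g k t‖ ≤ R)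
    (hηI : ∀ a b, a + b ≤ s → Integrable (wInt m0 a b fun _ w => η w) μTR)
    (hgI : ∀ a b, a + b ≤ s → Integrable (wInt m0 a b (g t)) μTR)
    (hηE : ∀ a b, a + b ≤ s → ∫ z, wInt m0 a b (fun _ w => η w) z ∂μTR ≤ E)
    (hgE : ∀ a b, a + b ≤ s - 4 → ∫ z, wInt m0 a b (g t) z ∂μTR ≤ E)
    (hgE' : ∀ a b, a + b ≤ s → ∫ z, wInt m0 a b (g t) z ∂μTR ≤ E * jap t ^ 6) :
    ∫⁻ z, ENNReal.ofReal (jap t ^ (2 * (s - 2)) * wInt m0 p q (pT g t) z) ∂μTR ≤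
      ENNReal.ofReal ((2 * (2 * (π * R * ((s + 1) * ((s + 1) * (2 ^ s * 2 ^ s * 2))))) ^ 2 *
        (s * s : ℕ) * ((s * s : ℕ) * (E + ε ^ 2 * E))) * jap t ^ (2 * (p + q))) := by
  have hJ := one_le_jap t
  have hJ0 := jap_pos t
  have hR : 0 ≤ R := le_trans (by positivity) (hz 1 (Or.inl rfl))
  have hE0 : 0 ≤ E := (integral_nonneg (wInt_nonneg m0 0 0 _)).trans (hηE 0 0 (by omega))
  set K : ℝ := 2 * (π * R * ((s + 1) * ((s + 1) * (2 ^ s * 2 ^ s * 2)))) with hK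
  have hK0 : 0 ≤ K := by positivity
  set S : Finset (ℕ × ℕ) := (Finset.range s ×ˢ Finset.range s).filter
    fun i => 1 ≤ i.1 + i.2 ∧ i.1 + i.2 ≤ p + q + 1 with hS
  have hcard : (S.card : ℝ) ≤ (s * s : ℕ) := by
    have := Finset.card_filter_le (Finset.range s ×ˢ Finset.range s)
      fun i => 1 ≤ i.1 + i.2 ∧ i.1 + i.2 ≤ p + q + 1
    rw [Finset.card_product, Finset.card_range] at this
    exact_mod_cast this
  have hSm : ∀ i ∈ S, 1 ≤ i.1 + i.2 ∧ i.1 + i.2 ≤ p + q + 1 := fun i hi =>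
    (Finset.mem_filter.1 hi).2
  have hmS : ∀ a b, 1 ≤ a + b → a + b ≤ p + q + 1 → (a, b) ∈ S := fun a b h1 h2 => by
    simp only [hS, Finset.mem_filter, Finset.mem_product, Finset.mem_range]
    omega
  refine lintegral_ofReal_le_of_le (F := fun z => ∑ i ∈ S,
    (2 * K ^ 2 * (s * s : ℕ) * (jap t ^ (p + q + 1 - (i.1 + i.2))) ^ 2) *
      (wInt m0 i.1 i.2 (fun _ w => η w) z + ε ^ 2 * wInt m0 i.1 i.2 (g t) z)) ?_ ?_ ?_ ?_
  · intro z
    have hw := weight_pos m0 z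
    set T : ℝ := ∑ i ∈ S, jap t ^ (p + q + 1 - (i.1 + i.2)) *
      ‖dXV i.1 i.2 (totalState ε η g t) z.1 z.2‖ with hT
    have hu := norm_dXV_pT_le_of_le (T := T) (p := p) (q := q) (s := s) (by omega) (by omega)
      (hη.of_le (by exact_mod_cast (by omega : p + q + 1 ≤ s))) hg hsol hgi hz z.1 z.2 ?_
    · have hsq : T ^ 2 ≤ (s * s : ℕ) * ∑ i ∈ S, (jap t ^ (p + q + 1 - (i.1 + i.2))) ^ 2 *
          (2 * (‖dXV i.1 i.2 (fun _ w => η w) z.1 z.2‖ ^ 2 +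
            ε ^ 2 * ‖dXV i.1 i.2 (g t) z.1 z.2‖ ^ 2)) := by
        refine sq_sum_le_card_mul_sum_sq.trans ?_
        refine mul_le_mul hcard (Finset.sum_le_sum fun i hi => ?_)
          (Finset.sum_nonneg fun i _ => sq_nonneg _) (by positivity)
        rw [mul_pow, dXV_totalState (hη.of_le (by
          have := hSm i hi
          exact_mod_cast (by omega : i.1 + i.2 ≤ s))) hg]
        gcongr
        exact sq_norm_add_mul_le _ _ _
      calc jap t ^ (2 * (s - 2)) * wInt m0 p q (pT g t) z
          = (1 + z.2 ^ 2) ^ m0 * (jap t ^ (s - 2) * ‖dXV p q (pT g t) z.1 z.2‖) ^ 2 := by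
            rw [wInt_eq]; ring
        _ ≤ (1 + z.2 ^ 2) ^ m0 * (K * T) ^ 2 := by gcongr
        _ = (1 + z.2 ^ 2) ^ m0 * K ^ 2 * T ^ 2 := by ring
        _ ≤ _ := mul_le_mul_of_nonneg_left hsq (by positivity)
        _ = _ := by
            simp only [Finset.mul_sum, wInt_eq]
            refine Finset.sum_congr rfl fun i _ => ?_
            ring
    · intro a b l hl hab
      have := Finset.single_le_sum (f := fun i : ℕ × ℕ => jap t ^ (p + q + 1 - (i.1 + i.2)) *
        ‖dXV i.1 i.2 (totalState ε η g t) z.1 z.2‖) (fun i _ => by positivity)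
        (hmS a b (by omega) (by omega))
      simp only at this
      rwa [show p + q + 1 - (a + b) = p + q - l by omega] at this
  · intro z
    refine Finset.sum_nonneg fun i _ => ?_
    have := wInt_nonneg m0 i.1 i.2 (fun _ w => η w) z
    have := wInt_nonneg m0 i.1 i.2 (g t) z
    positivity
  · refine integrable_finsetSum _ fun i hi => ?_
    have := hSm i hi
    exact ((hηI _ _ (by omega)).add ((hgI _ _ (by omega)).const_mul _)).const_mul _
  · rw [integral_finsetSum _ fun i hi => by
      have := hSm i hi
      exact ((hηI _ _ (by omega)).add ((hgI _ _ (by omega)).const_mul _)).const_mul _]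
    have hterm : ∀ i ∈ S, ∫ z, (2 * K ^ 2 * (s * s : ℕ) *
        (jap t ^ (p + q + 1 - (i.1 + i.2))) ^ 2) *
        (wInt m0 i.1 i.2 (fun _ w => η w) z + ε ^ 2 * wInt m0 i.1 i.2 (g t) z) ∂μTR ≤
        2 * K ^ 2 * (s * s : ℕ) * ((E + ε ^ 2 * E) * jap t ^ (2 * (p + q))) := by
      intro i hi
      have hi' := hSm i hi
      rw [integral_const_mul, integral_add (hηI _ _ (by omega)) ((hgI _ _ (by omega)).const_mul _),
        integral_const_mul, mul_assoc]
      refine mul_le_mul_of_nonneg_left ?_ (by positivity)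
      have hη1 := hηE i.1 i.2 (by omega)
      have step : ∀ e : ℕ, 2 * (p + q + 1 - (i.1 + i.2)) + e ≤ 2 * (p + q) →
          ∫ z, wInt m0 i.1 i.2 (g t) z ∂μTR ≤ E * jap t ^ e →
          (jap t ^ (p + q + 1 - (i.1 + i.2))) ^ 2 * (∫ z, wInt m0 i.1 i.2 (fun _ w => η w) z ∂μTR +
            ε ^ 2 * ∫ z, wInt m0 i.1 i.2 (g t) z ∂μTR) ≤
          (E + ε ^ 2 * E) * jap t ^ (2 * (p + q)) := by
        intro e he hge
        have hEJ : E ≤ E * jap t ^ e := le_mul_of_one_le_right hE0 (one_le_pow₀ hJ)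
        calc _ ≤ (jap t ^ (p + q + 1 - (i.1 + i.2))) ^ 2 *
              (E * jap t ^ e + ε ^ 2 * (E * jap t ^ e)) := by
              gcongr
              exact hη1.trans hEJ
          _ = (E + ε ^ 2 * E) * jap t ^ (2 * (p + q + 1 - (i.1 + i.2)) + e) := by ring
          _ ≤ _ := by gcongr
      by_cases h4 : i.1 + i.2 ≤ s - 4
      · exact step 0 (by omega) (by simpa using hgE _ _ h4)
      · exact step 6 (by omega) (hgE' _ _ (by omega))
    refine (Finset.sum_le_sum hterm).trans ?_
    rw [Finset.sum_const, nsmul_eq_mul]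
    calc _ ≤ ((s * s : ℕ) : ℝ) *
          (2 * K ^ 2 * (s * s : ℕ) * ((E + ε ^ 2 * E) * jap t ^ (2 * (p + q)))) := by gcongr
      _ = _ := by ring

lemma ofReal_sq_setIntegral_norm_le {f : ℝ → ℂ} (hf : Continuous f) {t : ℝ} (ht : 0 ≤ t) :
    ENNReal.ofReal ((∫ τ in Ioi t, ‖f τ‖) ^ 2) ≤
      ENNReal.ofReal (4 / jap t) * ∫⁻ τ in Ioi t, ENNReal.ofReal (jap τ ^ 2 * ‖f τ‖ ^ 2) := by
  have hcj := continuous_jap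
  have h1 : ENNReal.ofReal (∫ τ in Ioi t, ‖f τ‖) ≤ ∫⁻ τ in Ioi t, ENNReal.ofReal ‖f τ‖ := by
    rw [integral_eq_lintegral_of_nonneg_ae (Filter.Eventually.of_forall fun _ => norm_nonneg _)
      hf.norm.aestronglyMeasurable]
    exact ENNReal.ofReal_toReal_le
  have h2 := ENNReal.lintegral_mul_le_Lp_mul_Lq (volume.restrict (Ioi t))
    Real.HolderConjugate.two_two (f := fun τ => ENNReal.ofReal (jap τ)⁻¹)
    (g := fun τ => ENNReal.ofReal (jap τ * ‖f τ‖))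
    (hcj.measurable.inv.ennreal_ofReal.aemeasurable)
    ((hcj.mul hf.norm).measurable.ennreal_ofReal.aemeasurable)
  have e1 : ∀ τ, ((fun τ => ENNReal.ofReal (jap τ)⁻¹) * fun τ => ENNReal.ofReal (jap τ * ‖f τ‖)) τ
      = ENNReal.ofReal ‖f τ‖ := by
    intro τ
    have := jap_pos τ
    simp only [Pi.mul_apply]
    rw [← ENNReal.ofReal_mul (by positivity), inv_mul_cancel_left₀ this.ne']
  have e2 : ∀ τ, ENNReal.ofReal (jap τ)⁻¹ ^ (2 : ℝ) = ENNReal.ofReal (1 + τ ^ 2)⁻¹ := by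
    intro τ
    have := jap_pos τ
    rw [ENNReal.rpow_two, ← ENNReal.ofReal_pow (by positivity), inv_pow, jap_sq]
  have e3 : ∀ τ, ENNReal.ofReal (jap τ * ‖f τ‖) ^ (2 : ℝ) =
      ENNReal.ofReal (jap τ ^ 2 * ‖f τ‖ ^ 2) := by
    intro τ
    have := jap_pos τ
    rw [ENNReal.rpow_two, ← ENNReal.ofReal_pow (by positivity), mul_pow]
  simp only [e1, e2, e3] at h2
  have h3 : ∫⁻ τ in Ioi t, ENNReal.ofReal (1 + τ ^ 2)⁻¹ ≤ ENNReal.ofReal (4 / jap t) :=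
    lintegral_ofReal_le_of_le (fun _ => le_rfl) (fun _ => by positivity)
      integrable_inv_one_add_sq.integrableOn (tail_integral_le ht)
  rw [ENNReal.ofReal_pow (by positivity)]
  refine (pow_le_pow_left' (h1.trans h2) 2).trans ?_
  rw [mul_pow, ← ENNReal.rpow_two, ← ENNReal.rpow_two, ← ENNReal.rpow_mul, ← ENNReal.rpow_mul]
  norm_num
  gcongr

lemma jap_le_jap {t τ : ℝ} (ht : 0 ≤ t) (h : t ≤ τ) : jap t ≤ jap τ :=
  Real.sqrt_le_sqrt (by gcongr)

/-- Minkowski-type bound: decay of the weighted mean square of `u` gives decay of the weighted mean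
square of any function dominated by the tail integral of `u`. -/
lemma lintegral_weight_sq_tail_le {m0 N t : ℝ} {k : ℕ} {u : ℝ → ℝ → ℝ → ℂ} {D : ℝ × ℝ → ℂ}
    (ht : 0 ≤ t) (hu : Continuous fun z : ℝ × ℝ × ℝ => u z.1 z.2.1 z.2.2)
    (hD : ∀ z, ‖D z‖ ≤ ∫ τ in Ioi t, ‖u τ z.1 z.2‖)
    (hN : ∀ τ, 0 ≤ τ → ∫⁻ z, ENNReal.ofReal (jap τ ^ (2 * k + 4) *
      ((1 + z.2 ^ 2) ^ m0 * ‖u τ z.1 z.2‖ ^ 2)) ∂μTR ≤ ENNReal.ofReal N) :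
    ∫⁻ z, ENNReal.ofReal ((1 + z.2 ^ 2) ^ m0 * ‖D z‖ ^ 2) ∂μTR ≤
      ENNReal.ofReal (16 * N / jap t ^ (2 * k + 2)) := by
  have hJ0 := jap_pos t
  have hcj := continuous_jap
  have hw : Measurable fun z : ℝ × ℝ => (1 + z.2 ^ 2) ^ m0 := by fun_prop
  have hmeas : Measurable (Function.uncurry fun (z : ℝ × ℝ) (τ : ℝ) =>
      ENNReal.ofReal ((1 + z.2 ^ 2) ^ m0 * (jap τ ^ 2 * ‖u τ z.1 z.2‖ ^ 2))) := by
    simp only [Function.uncurry_def]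
    have h1 : Continuous fun y : (ℝ × ℝ) × ℝ => jap y.2 ^ 2 * ‖u y.2 y.1.1 y.1.2‖ ^ 2 := by
      have h2 : Continuous fun y : (ℝ × ℝ) × ℝ => u y.2 y.1.1 y.1.2 :=
        hu.comp (by fun_prop : Continuous fun y : (ℝ × ℝ) × ℝ => (y.2, y.1.1, y.1.2))
      fun_prop
    exact ((hw.comp measurable_fst).mul h1.measurable).ennreal_ofReal
  have hslice : ∀ z : ℝ × ℝ, Continuous fun τ => u τ z.1 z.2 := fun z =>
    hu.comp (by fun_prop : Continuous fun τ : ℝ => (τ, z.1, z.2))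
  calc _ ≤ ∫⁻ z, (ENNReal.ofReal (4 / jap t) * ∫⁻ τ in Ioi t, ENNReal.ofReal
        ((1 + z.2 ^ 2) ^ m0 * (jap τ ^ 2 * ‖u τ z.1 z.2‖ ^ 2))) ∂μTR := by
        refine lintegral_mono fun z => ?_
        have hwz := weight_pos m0 z
        simp only [ENNReal.ofReal_mul hwz.le]
        rw [lintegral_const_mul' _ _ ENNReal.ofReal_ne_top, mul_left_comm]
        gcongr
        refine le_trans (ENNReal.ofReal_le_ofReal ?_) (ofReal_sq_setIntegral_norm_le (hslice z) ht)
        exact pow_le_pow_left₀ (norm_nonneg _) (hD z) 2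
    _ = ENNReal.ofReal (4 / jap t) * ∫⁻ τ in Ioi t, (∫⁻ z, ENNReal.ofReal
        ((1 + z.2 ^ 2) ^ m0 * (jap τ ^ 2 * ‖u τ z.1 z.2‖ ^ 2)) ∂μTR) := by
        rw [lintegral_const_mul' _ _ ENNReal.ofReal_ne_top]
        congr 1
        have : SFinite μTR := by unfold μTR; infer_instance
        exact lintegral_lintegral_swap hmeas.aemeasurable
    _ ≤ ENNReal.ofReal (4 / jap t) * ∫⁻ τ in Ioi t, ENNReal.ofReal (jap t ^ (2 * k))⁻¹ *
        ENNReal.ofReal N * ENNReal.ofReal (1 + τ ^ 2)⁻¹ := by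
        refine mul_le_mul' le_rfl ?_
        refine setLIntegral_mono' measurableSet_Ioi fun τ hτ => ?_
        have hτt : t ≤ τ := le_of_lt hτ
        have hJτ := jap_pos τ
        calc _ = ∫⁻ z, ENNReal.ofReal (jap τ ^ (2 * k + 2))⁻¹ * ENNReal.ofReal
              (jap τ ^ (2 * k + 4) * ((1 + z.2 ^ 2) ^ m0 * ‖u τ z.1 z.2‖ ^ 2)) ∂μTR := by
              refine lintegral_congr fun z => ?_
              rw [← ENNReal.ofReal_mul (by positivity)]
              congr 1
              rw [show 2 * k + 4 = (2 * k + 2) + 2 by ring, pow_add (jap τ) (2 * k + 2) 2]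
              field_simp
          _ ≤ ENNReal.ofReal (jap τ ^ (2 * k + 2))⁻¹ * ENNReal.ofReal N := by
              rw [lintegral_const_mul' _ _ ENNReal.ofReal_ne_top]
              gcongr
              exact hN τ (ht.trans hτt)
          _ ≤ (ENNReal.ofReal (jap t ^ (2 * k))⁻¹ * ENNReal.ofReal (1 + τ ^ 2)⁻¹) *
              ENNReal.ofReal N := by
              rw [← ENNReal.ofReal_mul (p := (jap t ^ (2 * k))⁻¹) (by positivity)]
              refine mul_le_mul' (ENNReal.ofReal_le_ofReal ?_) le_rfl
              rw [pow_add, jap_sq, mul_inv]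
              exact mul_le_mul_of_nonneg_right (inv_anti₀ (by positivity)
                (pow_le_pow_left₀ hJ0.le (jap_le_jap ht hτt) _)) (by positivity)
          _ = _ := by ring
    _ ≤ ENNReal.ofReal (4 / jap t) * (ENNReal.ofReal (jap t ^ (2 * k))⁻¹ * ENNReal.ofReal N *
        ENNReal.ofReal (4 / jap t)) := by
        rw [lintegral_const_mul' _ _ (ENNReal.mul_ne_top ENNReal.ofReal_ne_top
          ENNReal.ofReal_ne_top)]
        gcongr
        exact lintegral_ofReal_le_of_le (fun _ => le_rfl) (fun _ => by positivity)
          integrable_inv_one_add_sq.integrableOn (tail_integral_le ht)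
    _ = _ := by
        rw [← ENNReal.ofReal_mul (by positivity), ← ENNReal.ofReal_mul' (by positivity),
          ← ENNReal.ofReal_mul (by positivity)]
        congr 1
        rw [pow_add]
        field_simp
        ring

lemma Hnorm_le_of_integral_le {m0 B : ℝ} {r : ℕ} {f : ℝ → ℝ → ℂ} (hB : 0 ≤ B)
    (h : ∀ p q, p + q ≤ r → ∫ z, wInt m0 p q f z ∂μTR ≤ B ^ 2) :
    Hnorm m0 r f ≤ (r + 1) * B := by
  refine Real.sqrt_le_iff.2 ⟨by positivity, ?_⟩
  calc HnormSq m0 r f ≤ ∑ _p ∈ Finset.range (r + 1), ∑ _q ∈ Finset.range (r + 1), B ^ 2 := by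
        refine Finset.sum_le_sum fun p hp => ?_
        rw [Finset.mem_range] at hp
        refine (Finset.sum_le_sum fun q hq => h p q ?_).trans
          (Finset.sum_le_sum_of_subset_of_nonneg (Finset.range_mono (by omega))
            fun _ _ _ => by positivity)
        rw [Finset.mem_range] at hq
        omega
    _ = _ := by
        simp only [Finset.sum_const, Finset.card_range, nsmul_eq_mul]
        push_cast
        ring

lemma dXV_sub {f h : ℝ → ℝ → ℂ} {p q : ℕ} (hf : ContDiff ℝ (p + q : ℕ) (Function.uncurry f))
    (hh : ContDiff ℝ (p + q : ℕ) (Function.uncurry h)) (x v : ℝ) :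
    dXV p q (fun x v => f x v - h x v) x v = dXV p q f x v - dXV p q h x v := by
  have := dXV_add_mul 1 (-1) hf hh x v
  simpa only [one_mul, neg_one_mul, ← sub_eq_add_neg] using this

lemma continuous_wInt {m0 : ℝ} {p q : ℕ} {f : ℝ → ℝ → ℂ}
    (hf : ContDiff ℝ (p + q : ℕ) (Function.uncurry f)) : Continuous (wInt m0 p q f) := by
  have h1 : Continuous fun z : ℝ × ℝ => dXV p q f z.1 z.2 :=
    (contDiff_dXV (n := 0) (by simpa using hf)).continuous
  have h2 : Continuous fun z : ℝ × ℝ => (1 + z.2 ^ 2) ^ m0 :=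
    Continuous.rpow_const (by fun_prop) fun z => Or.inl (by positivity)
  exact h2.mul (h1.norm.pow 2)

lemma integral_le_of_lintegral_ofReal_le {α : Type*} [MeasurableSpace α] {μ : Measure α}
    {f : α → ℝ} {B : ℝ} (hf : AEStronglyMeasurable f μ) (h0 : ∀ z, 0 ≤ f z) (hB : 0 ≤ B)
    (h : ∫⁻ z, ENNReal.ofReal (f z) ∂μ ≤ ENNReal.ofReal B) :
    Integrable f μ ∧ ∫ z, f z ∂μ ≤ B := by
  refine ⟨(lintegral_ofReal_ne_top_iff_integrable hf (Filter.Eventually.of_forall h0)).1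
    (h.trans_lt ENNReal.ofReal_lt_top).ne, ?_⟩
  rw [integral_eq_lintegral_of_nonneg_ae (Filter.Eventually.of_forall h0) hf]
  exact ENNReal.toReal_le_of_le_ofReal hB h

lemma wInt_le_add_sub {m0 : ℝ} {p q : ℕ} {f h : ℝ → ℝ → ℂ}
    (hf : ContDiff ℝ (p + q : ℕ) (Function.uncurry f))
    (hh : ContDiff ℝ (p + q : ℕ) (Function.uncurry h)) (z : ℝ × ℝ) :
    wInt m0 p q h z ≤ 2 * (wInt m0 p q f z + wInt m0 p q (fun x v => f x v - h x v) z) := by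
  simp only [wInt_eq, dXV_sub hf hh]
  have h1 := sq_norm_add_mul_le (-1) (dXV p q f z.1 z.2) (dXV p q f z.1 z.2 - dXV p q h z.1 z.2)
  have h2 : dXV p q f z.1 z.2 + ((-1 : ℝ) : ℂ) * (dXV p q f z.1 z.2 - dXV p q h z.1 z.2) =
      dXV p q h z.1 z.2 := by push_cast; ring
  rw [h2] at h1
  calc _ ≤ (1 + z.2 ^ 2) ^ m0 * _ := mul_le_mul_of_nonneg_left h1 (weight_pos m0 z).le
    _ = _ := by ring

/-- **Corollary (scattering).** Under the hypotheses of the main a priori bound (with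
`0 < ε ≤ ε₀` so that `Q_{T,s}(g) ≤ R` for all `T ≥ 0`), there exist a constant `C` and a
state `g^∞ ∈ ℋ^{s-4}` such that for every integer `1 ≤ r ≤ s-4` and all `t ≥ 0`,
`‖g(t) - g^∞‖_{ℋʳ} ≤ C/⟨t⟩^{s-r-3}`. -/
theorem scattering (s : ℕ) (hs : 7 ≤ s) (m0 : ℝ) (hm0 : 1 / 2 < m0)
    (η : ℝ → ℂ) (hη : MemH m0 (s + 4) fun _ v => η v) (hP : Penrose m0 η)
    (R0 R ε : ℝ) (hR0 : 0 < R0) (hR : 0 < R) (hε : 0 < ε)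
    (g : ℝ → ℝ → ℝ → ℂ) (hg : SmoothG g) (hgH : ∀ t : ℝ, MemH m0 s (g t))
    (hsol : IsVHMF ε η g) (hQ0 : Qle m0 s g 0 R0)
    (hQ : ∀ T : ℝ, 0 ≤ T → Qle m0 s g T R) :
    ∃ C : ℝ, ∃ ginf : ℝ → ℝ → ℂ, MemH m0 (s - 4) ginf ∧
      ∀ r : ℕ, 1 ≤ r → r ≤ s - 4 → ∀ t : ℝ, 0 ≤ t →
        Hnorm m0 r (fun x v => g t x v - ginf x v) ≤ C / jap t ^ (s - r - 3) := by
  have hηs : ContDiff ℝ s (Function.uncurry fun _ : ℝ => η) :=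
    hη.1.of_le (by exact_mod_cast (by omega : s ≤ s + 4))
  have hgi : ∀ t, Integrable (fun z : ℝ × ℝ => g t z.1 z.2) μTR := fun t => (hgH t).integrable hm0
  have hb := fun t ht => (hQ t ht).bounds ht
  have hz : ∀ t, 0 ≤ t → ∀ k : ℤ, k = 1 ∨ k = -1 → jap t ^ (s - 1) * ‖zeta g k t‖ ≤ R :=
    fun t ht => (hb t ht).2.1
  have hgs4 : ∀ t, MemH m0 (s - 4) (g t) := fun t => ⟨hg.contDiff_slice _ t, (hgH t).2.1,
    fun p q h => (hgH t).2.2 p q (by omega)⟩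
  set H := Hnorm m0 (s + 4) fun _ v => η v with hH
  have hH0 : 0 ≤ H := Hnorm_nonneg _ _ _
  obtain ⟨M, hM⟩ := exists_norm_dXV_pT_le (C := 4 * H + 4 * R) hs hηs hg hsol hε.le hgi hz
    (fun a b hab x v => (norm_dXV_le_Hnorm (by linarith) (by omega) hη x v).trans (by linarith))
    (fun a b hab t ht x v => (norm_dXV_le_Hnorm (by linarith) (by omega) (hgs4 t) x v).trans
      (by linarith [(hb t ht).2.2]))
    (fun a b hab t ht x v => by
      refine (norm_dXV_le_Hnorm (by linarith) (by omega) (hgH t) x v).trans ?_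
      have hJ := jap_pos t
      have h1 : 0 ≤ H * jap t ^ 3 := by positivity
      nlinarith [(hb t ht).1])
  obtain ⟨ginf, hsm, hlim⟩ := exists_limit_profile hg hM
  set E := H ^ 2 + R ^ 2 with hE
  set N := 2 * (2 * (π * R * ((s + 1) * ((s + 1) * (2 ^ s * 2 ^ s * 2))))) ^ 2 *
        (s * s : ℕ) * ((s * s : ℕ) * (E + ε ^ 2 * E)) with hN
  have hN0 : 0 ≤ N := by positivity
  have hu : ∀ p q, p + q ≤ s - 4 → ∀ t, 0 ≤ t →
      ∫⁻ z, ENNReal.ofReal (jap t ^ (2 * (s - 2)) * wInt m0 p q (pT g t) z) ∂μTR ≤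
      ENNReal.ofReal (N * jap t ^ (2 * (p + q))) := by
    intro p q hpq t ht
    have hJ := jap_pos t
    refine lintegral_wInt_pT_le hs hpq hηs hg hsol (hgi t) (hz t ht)
      (fun a b h => hη.2.2 a b (by omega)) (hgH t).2.2 (fun a b h => ?_) (fun a b h => ?_)
      (fun a b h => ?_)
    · have := integral_wInt_le_HnormSq m0 (by omega : a + b ≤ s + 4) fun _ v => η v
      rw [← sq_Hnorm] at this
      nlinarith [sq_nonneg R]
    · have := integral_wInt_le_HnormSq m0 h (g t)
      rw [← sq_Hnorm] at this
      have h2 := pow_le_pow_left₀ (Hnorm_nonneg _ _ _) (hb t ht).2.2 2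
      nlinarith [sq_nonneg H]
    · have := integral_wInt_le_HnormSq m0 h (g t)
      rw [← sq_Hnorm] at this
      have h2 := pow_le_pow_left₀ (Hnorm_nonneg _ _ _) (hb t ht).1 2
      have h3 : 0 ≤ H ^ 2 * jap t ^ 6 := by positivity
      nlinarith
  have hdiff : ∀ p q, p + q ≤ s - 4 → ∀ t, 0 ≤ t →
      Integrable (wInt m0 p q fun x v => g t x v - ginf x v) μTR ∧
      ∫ z, wInt m0 p q (fun x v => g t x v - ginf x v) z ∂μTR ≤
        16 * N / jap t ^ (2 * (s - 4 - (p + q)) + 2) := by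
    intro p q hpq t ht
    have hJ := jap_pos t
    have hsm' : ContDiff ℝ (p + q : ℕ) (Function.uncurry ginf) :=
      hsm.of_le (by exact_mod_cast hpq)
    have hgc := hg.contDiff_slice (p + q) t
    refine integral_le_of_lintegral_ofReal_le
      (continuous_wInt (hgc.sub hsm')).aestronglyMeasurable (wInt_nonneg _ _ _ _)
      (by positivity) ?_
    simp only [wInt_eq, dXV_sub hgc hsm']
    refine lintegral_weight_sq_tail_le (u := fun τ => dXV p q (pT g τ)) ht
      ((hg.pT.dXV p q) 0).continuous (fun z => (hlim p q hpq z.1 z.2).2 t ht) fun τ hτ => ?_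
    have hJτ := jap_pos τ
    have e : ∀ z, jap τ ^ (2 * (s - 4 - (p + q)) + 4) *
        ((1 + z.2 ^ 2) ^ m0 * ‖dXV p q (pT g τ) z.1 z.2‖ ^ 2) =
        (jap τ ^ (2 * (p + q)))⁻¹ * (jap τ ^ (2 * (s - 2)) * wInt m0 p q (pT g τ) z) := by
      intro z
      rw [wInt_eq, show 2 * (s - 2) = 2 * (p + q) + (2 * (s - 4 - (p + q)) + 4) by omega,
        pow_add _ (2 * (p + q)), mul_assoc (jap τ ^ (2 * (p + q))), inv_mul_cancel_left₀ (by positivity)]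
    simp only [e]
    calc _ = ENNReal.ofReal (jap τ ^ (2 * (p + q)))⁻¹ * ∫⁻ z, ENNReal.ofReal
          (jap τ ^ (2 * (s - 2)) * wInt m0 p q (pT g τ) z) ∂μTR := by
          rw [← lintegral_const_mul' _ _ ENNReal.ofReal_ne_top]
          refine lintegral_congr fun z => ?_
          rw [← ENNReal.ofReal_mul (by positivity)]
      _ ≤ ENNReal.ofReal (jap τ ^ (2 * (p + q)))⁻¹ *
          ENNReal.ofReal (N * jap τ ^ (2 * (p + q))) := mul_le_mul' le_rfl (hu p q hpq τ hτ)
      _ = _ := by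
          rw [← ENNReal.ofReal_mul (by positivity)]
          congr 1
          field_simp
  refine ⟨(s + 1) * (4 * Real.sqrt N), ginf, ⟨?_, ?_, ?_⟩, ?_⟩
  · exact_mod_cast hsm
  · intro v x
    refine tendsto_nhds_unique (hlim 0 0 (by omega) (x + 2 * π) v).1 ?_
    refine (hlim 0 0 (by omega) x v).1.congr fun t => ?_
    exact ((hgH t).2.1 v x).symm
  · intro p q hpq
    have hpq' : p + q ≤ s - 4 := by omega
    have hsm' : ContDiff ℝ (p + q : ℕ) (Function.uncurry ginf) :=
      hsm.of_le (by exact_mod_cast hpq')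
    refine ((((hgH 0).2.2 p q (by omega)).add (hdiff p q hpq' 0 le_rfl).1).const_mul 2).mono'
      (continuous_wInt hsm').aestronglyMeasurable (Filter.Eventually.of_forall fun z => ?_)
    rw [Real.norm_of_nonneg (wInt_nonneg _ _ _ _ _)]
    exact wInt_le_add_sub (hg.contDiff_slice _ 0) hsm' z
  · intro r hr1 hr t ht
    have hJ := one_le_jap t
    have hJ0 := jap_pos t
    have hrs : (r : ℝ) ≤ s := by exact_mod_cast (by omega : r ≤ s)
    refine (Hnorm_le_of_integral_le (B := 4 * Real.sqrt N / jap t ^ (s - r - 3)) (by positivity)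
      fun p q hpq => (hdiff p q (by omega) t ht).2.trans ?_).trans ?_
    · rw [div_pow, mul_pow, Real.sq_sqrt hN0, ← pow_mul]
      norm_num only
      gcongr
      omega
    · rw [mul_div_assoc (s + 1 : ℝ)]
      exact mul_le_mul_of_nonneg_right (by linarith) (by positivity)
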